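/- arXiv:1701.01950 — 2 statements merged into one kernel-verified Lean document; each statement's English description precedes it below -/
import Mathlib

section
/- Let m ≥ 2, let λ₀ ∈ [1,2], let p satisfy λ₀m < p ≤ 2λ₀(m-1)/(2-λ₀), and set s = λ₀p/(p-λ₀m+λ₀), η₁ = λ₀p/(p-λ₀m). Then for every m-linear form T : (ℓ_p^n)^m → ℝ and every n, (Σ_{j₁=1}^n (Σ_{j₂,…,j_m=1}^n |T(e_{j₁},…,e_{j_m})|^s)^{η₁/s})^{1/η₁} ≤ A_{λ₀}^{-2(m-1)/s} ‖T‖, where A_{λ₀} is the optimal real Khinchin constant and ‖T‖ is the operator norm of T on ℓ_p^n × ⋯ × ℓ_p^n. -/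
/-- The Rademacher functions `r_j(t) = sign (sin (2^j π t))` on `[0,1]`. -/
noncomputable def rademacher (j : ℕ) (t : ℝ) : ℝ :=
  Real.sign (Real.sin (2 ^ j * Real.pi * t))

/-- The optimal constant in the real Khinchin inequality
`A_q (∑ |a_j|²)^{1/2} ≤ (∫₀¹ |∑ a_j r_j(t)|^q dt)^{1/q}`. -/
noncomputable def khinchinA (q : ℝ) : ℝ :=
  sSup {A : ℝ | 0 < A ∧ ∀ (n : ℕ) (a : Fin n → ℝ),
    A * (∑ j, (a j) ^ 2) ^ ((1:ℝ)/2) ≤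
      (∫ t in (0:ℝ)..1, |∑ j, a j * rademacher j t| ^ q) ^ (1/q)}

theorem sum_rpow_mul_rpow_le {ι : Type*} (S : Finset ι) (x y : ι → ℝ) (hx : ∀ i, 0 ≤ x i)
    (hy : ∀ i, 0 ≤ y i) {θ φ : ℝ} (hθ : 0 ≤ θ) (hφ : 0 ≤ φ) (h : θ + φ = 1) :
    ∑ i ∈ S, x i ^ θ * y i ^ φ ≤ (∑ i ∈ S, x i) ^ θ * (∑ i ∈ S, y i) ^ φ := by
  rcases hθ.eq_or_lt with rfl | hθ
  · obtain rfl : φ = 1 := by linarith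
    simp
  rcases hφ.eq_or_lt with rfl | hφ
  · obtain rfl : θ = 1 := by linarith
    simp
  have hpq : (θ⁻¹).HolderConjugate φ⁻¹ := by
    rw [Real.holderConjugate_iff]
    refine ⟨(one_lt_inv₀ hθ).2 (by linarith), by simpa using h⟩
  have := Real.inner_le_Lp_mul_Lq_of_nonneg S hpq (f := fun i => x i ^ θ) (g := fun i => y i ^ φ)
    (fun i _ => Real.rpow_nonneg (hx i) _) (fun i _ => Real.rpow_nonneg (hy i) _)
  simpa only [one_div, inv_inv, Real.rpow_rpow_inv (hx _) hθ.ne',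
    Real.rpow_rpow_inv (hy _) hφ.ne'] using this

/-- Duality: bounds tested against the unit ball of a weighted space upgrade the exponent. -/
theorem sum_rpow_le_one_of_forall_ball {ι : Type*} [Fintype ι] (G : ι → ℝ) (hG : ∀ i, 0 ≤ G i)
    {α β π : ℝ} (hα : 0 < α) (hβ : 0 < β) (hπ : 0 < π) (hr : 1 / β = 1 / α - 1 / π)
    (H : ∀ y : ι → ℝ, (∀ i, 0 ≤ y i) → ∑ i, y i ^ π ≤ 1 → ∑ i, (G i * y i) ^ α ≤ 1) :
    ∑ i, G i ^ β ≤ 1 := by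
  by_contra! hN
  set N := ∑ i, G i ^ β with hNdef
  have hN0 : 0 < N := by linarith
  have h1 := H (fun i => (G i ^ β / N) ^ (1 / π))
    (fun i => Real.rpow_nonneg (div_nonneg (Real.rpow_nonneg (hG i) _) hN0.le) _) (by
      have : ∀ i, ((G i ^ β / N) ^ (1 / π)) ^ π = G i ^ β / N := fun i => by
        rw [one_div, Real.rpow_inv_rpow (div_nonneg (Real.rpow_nonneg (hG i) _) hN0.le) hπ.ne']
      simp only [this, ← Finset.sum_div]
      rw [← hNdef, div_self hN0.ne'])
  have hab : α + β * (1 / π) * α = β := by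
    have : 1 / π = 1 / α - 1 / β := by linarith
    rw [this]; field_simp; ring
  have h2 : ∀ i, (G i * (G i ^ β / N) ^ (1 / π)) ^ α = G i ^ β * N ^ (-(1 / π * α)) := fun i => by
    rw [Real.div_rpow (Real.rpow_nonneg (hG i) _) hN0.le, Real.mul_rpow (hG i) (by
      have := hG i; positivity), Real.div_rpow (by have := hG i; positivity) (by positivity),
      ← Real.rpow_mul (hG i), ← Real.rpow_mul (hG i), ← Real.rpow_mul hN0.le,
      Real.rpow_neg hN0.le, ← mul_div_assoc, ← Real.rpow_add_of_nonneg (hG i) hα.le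
        (by positivity), hab, div_eq_mul_inv]
  simp only [h2, ← Finset.sum_mul] at h1
  rw [← hNdef] at h1
  nth_rewrite 1 [← Real.rpow_one N] at h1
  rw [← Real.rpow_add hN0] at h1
  have h3 : 0 < 1 + -(1 / π * α) := by
    have : 1 / π = 1 / α - 1 / β := by linarith
    rw [this]
    have : 1 + -((1 / α - 1 / β) * α) = α / β := by field_simp; ring
    rw [this]; positivity
  linarith [Real.one_lt_rpow hN h3]

/-- Exchange of the outer summation index when one weight is removed. -/
theorem sum_fiber_rpow_le_one {Ω ι : Type*} [Fintype Ω] [Fintype ι] [DecidableEq ι]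
    (V : Ω → ℝ) (hV : ∀ ω, 0 ≤ V ω) (f g : Ω → ι) {α β π : ℝ} (hα : 0 < α) (hβ : 0 < β)
    (hβ1 : β ≤ 1) (hπ : 0 < π) (hr : 1 / β = 1 / α - 1 / π)
    (Hf : ∀ y : ι → ℝ, (∀ i, 0 ≤ y i) → ∑ i, y i ^ π ≤ 1 →
      ∑ t, (∑ ω with f ω = t, V ω * y (g ω)) ^ α ≤ 1)
    (Hg : ∀ y : ι → ℝ, (∀ i, 0 ≤ y i) → ∑ i, y i ^ π ≤ 1 →
      ∑ t, (∑ ω with g ω = t, V ω * y (g ω)) ^ α ≤ 1) :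
    ∑ t, (∑ ω with f ω = t, V ω) ^ β ≤ 1 := by
  set G : ι → ℝ := fun b => ∑ ω with g ω = b, V ω with hGdef
  have hG : ∀ b, 0 ≤ G b := fun b => Finset.sum_nonneg fun ω _ => hV ω
  have hGsum : ∑ b, G b ^ β ≤ 1 := by
    refine sum_rpow_le_one_of_forall_ball G hG hα hβ hπ hr fun y hy hy1 => ?_
    convert Hg y hy hy1 using 3 with b
    rw [hGdef, Finset.sum_mul]
    exact Finset.sum_congr rfl fun ω hω => by rw [(Finset.mem_filter.1 hω).2]
  have hπ1 : 0 < 1 / π := by positivity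
  have h1β : 1 ≤ 1 / β := (one_le_div hβ).2 hβ1
  have hden : 0 < 1 / α - 1 := by linarith
  obtain ⟨θ, hθ⟩ : ∃ θ, θ = (1 / β - 1) / (1 / α - 1) := ⟨_, rfl⟩
  have hθ0 : 0 ≤ θ := by rw [hθ]; exact div_nonneg (by linarith) hden.le
  have hθm : θ * (1 / α - 1) = 1 / β - 1 := by rw [hθ, div_mul_cancel₀ _ hden.ne']
  have hφm : (1 - θ) * (1 / α - 1) = 1 / π := by linarith
  have hφ0 : 0 < 1 - θ := by
    by_contra! h
    nlinarith
  have hexp : θ * (β / π) = (1 - β) * (1 - θ) := by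
    have h1 : β / π = β * ((1 - θ) * (1 / α - 1)) := by rw [hφm]; ring
    rw [h1]
    calc θ * (β * ((1 - θ) * (1 / α - 1))) = β * (1 - θ) * (θ * (1 / α - 1)) := by ring
      _ = (1 - β) * (1 - θ) := by rw [hθm]; field_simp
  have hexp2 : θ * (β / α) + (1 - θ) * β = 1 := by
    have : θ * (β / α) + (1 - θ) * β = β * (θ * (1 / α - 1)) + β := by ring
    rw [this, hθm]; field_simp; ring
  have hyb := Hf (fun b => G b ^ (β / π)) (fun b => Real.rpow_nonneg (hG b) _) (by
    simpa only [← Real.rpow_mul (hG _), div_mul_cancel₀ _ hπ.ne'] using hGsum)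
  set X : ι → ℝ := fun t => ∑ ω with f ω = t, V ω * G (g ω) ^ (β / π) with hX
  set Y : ι → ℝ := fun t => ∑ ω with f ω = t, V ω * G (g ω) ^ (β - 1) with hY
  have hX0 : ∀ t, 0 ≤ X t := fun t => Finset.sum_nonneg fun ω _ =>
    mul_nonneg (hV ω) (Real.rpow_nonneg (hG _) _)
  have hY0 : ∀ t, 0 ≤ Y t := fun t => Finset.sum_nonneg fun ω _ =>
    mul_nonneg (hV ω) (Real.rpow_nonneg (hG _) _)
  have hYsum : ∑ t, Y t ≤ 1 := by
    rw [hY, Finset.sum_fiberwise, ← Finset.sum_fiberwise Finset.univ g]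
    refine le_trans (Finset.sum_le_sum fun b _ => ?_) hGsum
    have : ∑ ω with g ω = b, V ω * G (g ω) ^ (β - 1) = G b * G b ^ (β - 1) := by
      conv_rhs => enter [1]; rw [hGdef]
      rw [Finset.sum_mul]
      exact Finset.sum_congr rfl fun ω hω => by rw [(Finset.mem_filter.1 hω).2]
    rw [this]
    rcases (hG b).eq_or_lt with h0 | h0
    · rw [← h0, zero_mul]; positivity
    · nth_rewrite 1 [← Real.rpow_one (G b)]
      rw [← Real.rpow_add h0]; simp
  have hle : ∀ t, ∑ ω with f ω = t, V ω ≤ X t ^ θ * Y t ^ (1 - θ) := fun t => by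
    refine le_trans (Finset.sum_le_sum fun ω _ => ?_) (sum_rpow_mul_rpow_le _ _ _
      (fun ω => mul_nonneg (hV ω) (Real.rpow_nonneg (hG _) _))
      (fun ω => mul_nonneg (hV ω) (Real.rpow_nonneg (hG _) _)) hθ0 hφ0.le (by ring))
    rcases (hG (g ω)).eq_or_lt with h0 | h0
    · have : V ω ≤ G (g ω) := Finset.single_le_sum (f := V) (fun ω _ => hV ω) (by simp)
      refine le_trans (this.trans h0.symm.le) ?_
      have := hV ω
      have := hG (g ω)
      positivity
    · rcases (hV ω).eq_or_lt with hv | hv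
      · rw [← hv]; positivity
      · rw [Real.mul_rpow hv.le (by positivity), Real.mul_rpow hv.le (by positivity),
          ← Real.rpow_mul h0.le, ← Real.rpow_mul h0.le]
        have : V ω ^ θ * G (g ω) ^ (β / π * θ) * (V ω ^ (1 - θ) * G (g ω) ^ ((β - 1) * (1 - θ)))
            = (V ω ^ θ * V ω ^ (1 - θ)) *
              (G (g ω) ^ (β / π * θ) * G (g ω) ^ ((β - 1) * (1 - θ))) := by ring
        rw [this, ← Real.rpow_add hv, ← Real.rpow_add h0]
        have e1 : θ + (1 - θ) = 1 := by ring
        have e2 : β / π * θ + (β - 1) * (1 - θ) = 0 := by linarith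
        rw [e1, e2]; simp
  calc ∑ t, (∑ ω with f ω = t, V ω) ^ β
      ≤ ∑ t, (X t ^ α) ^ (θ * (β / α)) * Y t ^ ((1 - θ) * β) := by
        refine Finset.sum_le_sum fun t _ => ?_
        refine (Real.rpow_le_rpow (Finset.sum_nonneg fun ω _ => hV ω) (hle t) hβ.le).trans_eq ?_
        rw [Real.mul_rpow (Real.rpow_nonneg (hX0 t) _) (Real.rpow_nonneg (hY0 t) _),
          ← Real.rpow_mul (hX0 t), ← Real.rpow_mul (hX0 t), ← Real.rpow_mul (hY0 t)]
        congr 2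
        field_simp
    _ ≤ (∑ t, X t ^ α) ^ (θ * (β / α)) * (∑ t, Y t) ^ ((1 - θ) * β) :=
        sum_rpow_mul_rpow_le _ _ _ (fun t => Real.rpow_nonneg (hX0 t) _) hY0
          (by positivity) (by positivity) hexp2
    _ ≤ 1 * 1 := by
        refine mul_le_mul (Real.rpow_le_one ?_ hyb (by positivity))
          (Real.rpow_le_one (Finset.sum_nonneg fun t _ => hY0 t) hYsum (by positivity))
          (Real.rpow_nonneg (Finset.sum_nonneg fun t _ => hY0 t) _) zero_le_one
        exact Finset.sum_nonneg fun t _ => Real.rpow_nonneg (hX0 t) _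
    _ = 1 := one_mul 1

/-- Removing weights one at a time: the outer exponent moves from `α` with
`1 / α = c` to `1 / α = c - #S / π`. -/
theorem sum_fiber_rpow_le_one_of_weights {ι κ : Type*} [Fintype ι] [DecidableEq ι] [Fintype κ]
    [DecidableEq κ] (V : (κ → ι) → ℝ) (hV : ∀ j, 0 ≤ V j) {c π : ℝ} (hπ : 0 < π)
    (H : ∀ w : κ → ι → ℝ, (∀ k t, 0 ≤ w k t) → (∀ k, ∑ t, w k t ^ π ≤ 1) → ∀ i,
      ∑ t, (∑ j with j i = t, V j * ∏ k, w k (j k)) ^ (1 / c) ≤ 1) (S : Finset κ) :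
    1 ≤ c - S.card / π → ∀ w : κ → ι → ℝ, (∀ k t, 0 ≤ w k t) →
      (∀ k ∉ S, ∑ t, w k t ^ π ≤ 1) → (∀ k ∈ S, ∀ t, w k t = 1) → ∀ i,
      ∑ t, (∑ j with j i = t, V j * ∏ k, w k (j k)) ^ (1 / (c - S.card / π)) ≤ 1 := by
  induction S using Finset.induction_on with
  | empty =>
    intro _ w hw hw1 _ i
    simpa using H w hw (fun k => hw1 k (by simp)) i
  | insert a S ha ih =>
    intro hc w hw hw1 hw2 i
    rw [Finset.card_insert_of_notMem ha] at hc ⊢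
    push_cast at hc ⊢
    have hstep : c - (S.card + 1) / π = c - S.card / π - 1 / π := by ring
    rw [hstep] at hc ⊢
    have hπ1 : 0 < 1 / π := by positivity
    have key : ∀ y : ι → ℝ, (∀ t, 0 ≤ y t) → ∑ t, y t ^ π ≤ 1 → ∀ i,
        ∑ t, (∑ j with j i = t, (V j * ∏ k, w k (j k)) * y (j a)) ^ (1 / (c - S.card / π)) ≤ 1 := by
      intro y hy hy1 i
      convert ih (by linarith) (Function.update w a y) (fun k t => ?_) (fun k hk => ?_)
        (fun k hk t => ?_) i using 4 with t _ j _
      · rw [mul_assoc]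
        congr 1
        rw [← Finset.mul_prod_erase _ _ (Finset.mem_univ a),
          ← Finset.mul_prod_erase _ (fun k => Function.update w a y k (j k)) (Finset.mem_univ a),
          hw2 a (by simp), one_mul, Function.update_self, mul_comm]
        congr 1
        refine Finset.prod_congr rfl fun k hk => ?_
        rw [Function.update_of_ne (Finset.ne_of_mem_erase hk)]
      · by_cases h : k = a
        · subst h; simpa using hy t
        · simpa [Function.update_of_ne h] using hw k t
      · by_cases h : k = a
        · subst h; simpa using hy1
        · simpa [Function.update_of_ne h] using hw1 k (by simp [h, hk])
      · have h : k ≠ a := fun h => ha (h ▸ hk)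
        simpa [Function.update_of_ne h] using hw2 k (by simp [hk]) t
    refine sum_fiber_rpow_le_one (α := 1 / (c - S.card / π)) (π := π) _
      (fun j => mul_nonneg (hV j) (Finset.prod_nonneg fun k _ => hw k _))
      (fun j => j i) (fun j => j a) (one_div_pos.2 (by linarith)) (one_div_pos.2 (by linarith))
      ?_ hπ ?_ (fun y hy hy1 => key y hy hy1 i) (fun y hy hy1 => key y hy hy1 a)
    · exact (div_le_one (by linarith)).2 hc
    · simp only [one_div_one_div]

/-- The average of `F` over all sign vectors of length `n`. -/
noncomputable def signAvg (n : ℕ) (F : (Fin n → ℝ) → ℝ) : ℝ :=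
  (∑ ε : Fin n → ℤˣ, F fun j => ((ε j : ℤ) : ℝ)) / 2 ^ n

theorem signAvg_succ (n : ℕ) (F : (Fin (n + 1) → ℝ) → ℝ) :
    signAvg (n + 1) F =
      (signAvg n (fun x => F (Fin.cons 1 x)) + signAvg n (fun x => F (Fin.cons (-1) x))) / 2 := by
  have h : ∀ (u : ℤˣ) (ε : Fin n → ℤˣ),
      (fun j => (((Fin.cons u ε : Fin (n + 1) → ℤˣ) j : ℤ) : ℝ)) =
        (Fin.cons ((u : ℤ) : ℝ) fun j => ((ε j : ℤ) : ℝ) : Fin (n + 1) → ℝ) := by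
    intro u ε
    ext j
    refine Fin.cases ?_ (fun j => ?_) j <;> simp
  unfold signAvg
  rw [← (Fin.consEquiv fun _ => ℤˣ).sum_comp, Fintype.sum_prod_type]
  simp only [Fin.consEquiv_apply, h]
  simp
  ring

theorem signAvg_neg (n : ℕ) (F : (Fin n → ℝ) → ℝ) :
    signAvg n (fun x => F (-x)) = signAvg n F := by
  unfold signAvg
  rw [← Equiv.sum_comp (Equiv.neg (Fin n → ℤˣ))]
  congr 1
  exact Finset.sum_congr rfl fun ε _ => congrArg F (funext fun j => by simp)

theorem signAvg_mono {n : ℕ} {F G : (Fin n → ℝ) → ℝ} (h : ∀ x, F x ≤ G x) :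
    signAvg n F ≤ signAvg n G :=
  div_le_div_of_nonneg_right (Finset.sum_le_sum fun _ _ => h _) (by positivity)

theorem rademacher_zero {t : ℝ} (ht : t ∈ Set.Ioo (0 : ℝ) 1) : rademacher 0 t = 1 := by
  refine Real.sign_of_pos (Real.sin_pos_of_pos_of_lt_pi ?_ ?_)
  · have := ht.1; positivity
  · have := ht.2; nlinarith [Real.pi_pos]

theorem rademacher_succ (j : ℕ) (t : ℝ) : rademacher (j + 1) t = rademacher j (2 * t) := by
  unfold rademacher
  congr 2
  ring

theorem rademacher_succ_sub_one (j : ℕ) (t : ℝ) :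
    rademacher (j + 1) (t - 1) = rademacher (j + 1) t := by
  unfold rademacher
  rw [← Real.sin_sub_nat_mul_two_pi (2 ^ (j + 1) * Real.pi * t) (2 ^ j)]
  congr 2
  push_cast
  ring

theorem rademacher_zero_of_mem_Ioo {t : ℝ} (ht : t ∈ Set.Ioo (1 : ℝ) 2) :
    rademacher 0 t = -1 := by
  have h := rademacher_zero (t := t - 1) ⟨by linarith [ht.1], by linarith [ht.2]⟩
  unfold rademacher at h ⊢
  have : (2 : ℝ) ^ 0 * Real.pi * t = 2 ^ 0 * Real.pi * (t - 1) + Real.pi := by ring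
  rw [this, Real.sin_add_pi, Real.sign_neg, h]

theorem integral_rademacher (n : ℕ) (G : (Fin n → ℝ) → ℝ) :
    IntervalIntegrable (fun t => G fun j => rademacher (j + 1) t) MeasureTheory.volume 0 1 ∧
      ∫ t in (0 : ℝ)..1, G (fun j => rademacher (j + 1) t) = signAvg n G := by
  induction n with
  | zero =>
    have h : ∀ t : ℝ, (fun j : Fin 0 => rademacher (j + 1) t) = fun j => ((1 : ℤ) : ℝ) :=
      fun t => Subsingleton.elim _ _
    simp only [h]
    refine ⟨by simp, ?_⟩
    simp only [signAvg, intervalIntegral.integral_const]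
    simp
    congr 1
    exact Subsingleton.elim _ _
  | succ n ih =>
    obtain ⟨i1, e1⟩ := ih fun x => G (Fin.cons 1 x)
    obtain ⟨i2, e2⟩ := ih fun x => G (Fin.cons (-1) x)
    set h1 : ℝ → ℝ := fun t => G (Fin.cons 1 fun j : Fin n => rademacher (j + 1) t) with hh1
    set h2 : ℝ → ℝ := fun t => G (Fin.cons (-1) fun j : Fin n => rademacher (j + 1) t) with hh2
    have c1 : Set.EqOn (fun t => h1 (2 * t))
        (fun t => G fun j : Fin (n + 1) => rademacher (j + 1) t) (Set.uIoo 0 (1 / 2)) := by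
      intro t ht
      rw [Set.uIoo_of_le (by norm_num)] at ht
      simp only [hh1]
      congr 1
      ext j
      refine Fin.cases ?_ (fun j => ?_) j
      · simp only [Fin.cons_zero, Fin.val_zero, rademacher_succ]
        exact (rademacher_zero ⟨by linarith [ht.1], by linarith [ht.2]⟩).symm
      · simp [rademacher_succ _ t]
    have c2 : Set.EqOn (fun t => h2 (2 * t - 1))
        (fun t => G fun j : Fin (n + 1) => rademacher (j + 1) t) (Set.uIoo (1 / 2) 1) := by
      intro t ht
      rw [Set.uIoo_of_le (by norm_num)] at ht
      simp only [hh2]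
      congr 1
      ext j
      refine Fin.cases ?_ (fun j => ?_) j
      · simp only [Fin.cons_zero, Fin.val_zero, rademacher_succ]
        exact (rademacher_zero_of_mem_Ioo ⟨by linarith [ht.1], by linarith [ht.2]⟩).symm
      · simp [rademacher_succ _ t, rademacher_succ_sub_one]
    have j1 : IntervalIntegrable (fun t => h1 (2 * t)) MeasureTheory.volume 0 (1 / 2) := by
      simpa using i1.comp_mul_left (c := 2)
    have j2 : IntervalIntegrable (fun t => h2 (2 * t - 1)) MeasureTheory.volume (1 / 2) 1 := by
      have := (i2.comp_sub_right 1).comp_mul_left (c := 2)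
      norm_num at this
      simpa using this
    have k1 := j1.congr_uIoo c1
    have k2 := j2.congr_uIoo c2
    refine ⟨k1.trans k2, ?_⟩
    rw [← intervalIntegral.integral_add_adjacent_intervals k1 k2,
      ← intervalIntegral.integral_congr_uIoo c1, ← intervalIntegral.integral_congr_uIoo c2,
      intervalIntegral.integral_comp_mul_left _ two_ne_zero,
      intervalIntegral.integral_comp_mul_sub _ two_ne_zero, signAvg_succ, ← e1, ← e2]
    norm_num
    ring

theorem integral_abs_sum_rademacher (n : ℕ) (a : Fin n → ℝ) (q : ℝ) :
    ∫ t in (0 : ℝ)..1, |∑ j, a j * rademacher j t| ^ q =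
      signAvg n fun x => |∑ j, a j * x j| ^ q := by
  cases n with
  | zero => simp [signAvg]
  | succ n =>
    have h := (integral_rademacher n fun x => |a 0 + ∑ j, a j.succ * x j| ^ q).2
    have c : Set.EqOn (fun t => |∑ j : Fin (n + 1), a j * rademacher j t| ^ q)
        (fun t => |a 0 + ∑ j : Fin n, a j.succ * rademacher (j + 1) t| ^ q) (Set.uIoo 0 1) := by
      intro t ht
      rw [Set.uIoo_of_le zero_le_one] at ht
      simp [Fin.sum_univ_succ, rademacher_zero ht]
    rw [intervalIntegral.integral_congr_uIoo c, h, signAvg_succ]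
    have h' : signAvg n (fun x => |∑ j, a j * (Fin.cons (-1) x : Fin (n + 1) → ℝ) j| ^ q) =
        signAvg n (fun x => |∑ j, a j * (Fin.cons 1 x : Fin (n + 1) → ℝ) j| ^ q) := by
      rw [← signAvg_neg]
      congr 1
      ext x
      rw [← abs_neg]
      simp [Fin.sum_univ_succ, add_comm]
    rw [h', add_self_div_two]
    simp [Fin.sum_univ_succ]

theorem signAvg_sq_and_four (n : ℕ) (a : Fin n → ℝ) :
    signAvg n (fun x => (∑ j, a j * x j) ^ 2) = ∑ j, a j ^ 2 ∧
      signAvg n (fun x => (∑ j, a j * x j) ^ 4) ≤ 3 * (∑ j, a j ^ 2) ^ 2 := by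
  induction n with
  | zero => simp [signAvg]
  | succ n ih =>
    obtain ⟨h2, h4⟩ := ih fun j => a j.succ
    have hlin : ∀ F : (Fin n → ℝ) → ℝ, ∀ c d : ℝ, ∀ F' : (Fin n → ℝ) → ℝ,
        signAvg n (fun x => F x + c * F' x + d) = signAvg n F + c * signAvg n F' + d := by
      intro F c d F'
      simp only [signAvg, Finset.sum_add_distrib, ← Finset.mul_sum]
      simp [add_div, mul_div_assoc]
    have hadd : ∀ F G : (Fin n → ℝ) → ℝ,
        signAvg n F + signAvg n G = signAvg n (fun x => F x + G x) := by
      intro F G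
      simp only [signAvg, Finset.sum_add_distrib, add_div]
    have s2 := hlin (fun x => (∑ j, a j.succ * x j) ^ 2) 1 (2 * a 0 ^ 2)
      (fun x => (∑ j, a j.succ * x j) ^ 2)
    have s4 := hlin (fun x => (∑ j, a j.succ * x j) ^ 4) 1 0
      (fun x => (∑ j, a j.succ * x j) ^ 4)
    have s42 := hlin (fun x => (∑ j, a j.succ * x j) ^ 4 + 1 * (∑ j, a j.succ * x j) ^ 4 + 0)
      (12 * a 0 ^ 2) (2 * a 0 ^ 4) (fun x => (∑ j, a j.succ * x j) ^ 2)
    rw [s4] at s42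
    rw [signAvg_succ, signAvg_succ, hadd, hadd]
    simp only [Fin.sum_univ_succ, Fin.cons_zero, Fin.cons_succ]
    constructor
    · rw [h2] at s2
      have e : ∀ x : Fin n → ℝ, (a 0 * 1 + ∑ j, a j.succ * x j) ^ 2 +
          (a 0 * -1 + ∑ j, a j.succ * x j) ^ 2 =
          (∑ j, a j.succ * x j) ^ 2 + 1 * (∑ j, a j.succ * x j) ^ 2 + 2 * a 0 ^ 2 :=
        fun x => by ring
      simp only [e]
      rw [s2]; ring
    · rw [h2] at s42
      have e : ∀ x : Fin n → ℝ, (a 0 * 1 + ∑ j, a j.succ * x j) ^ 4 +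
          (a 0 * -1 + ∑ j, a j.succ * x j) ^ 4 =
          (∑ j, a j.succ * x j) ^ 4 + 1 * (∑ j, a j.succ * x j) ^ 4 + 0 +
            12 * a 0 ^ 2 * (∑ j, a j.succ * x j) ^ 2 + 2 * a 0 ^ 4 :=
        fun x => by ring
      simp only [e]
      rw [s42]
      nlinarith [sq_nonneg (a 0 ^ 2)]

theorem signAvg_abs_rpow_ge (n : ℕ) (a : Fin n → ℝ) {q : ℝ} (hq1 : 1 ≤ q) (hq2 : q ≤ 2) :
    1 / 8 * (∑ j, a j ^ 2) ^ ((1 : ℝ) / 2) ≤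
      (signAvg n fun x => |∑ j, a j * x j| ^ q) ^ (1 / q) := by
  obtain ⟨h2, h4⟩ := signAvg_sq_and_four n a
  have hq0 : 0 < q := by linarith
  have hA0 : 0 ≤ ∑ j, a j ^ 2 := Finset.sum_nonneg fun j _ => sq_nonneg _
  set σ := (∑ j, a j ^ 2) ^ ((1 : ℝ) / 2) with hσ
  have hσ0 : 0 ≤ σ := Real.rpow_nonneg hA0 _
  have hσ2 : ∑ j, a j ^ 2 = σ ^ 2 := by
    rw [hσ, ← Real.sqrt_eq_rpow, Real.sq_sqrt hA0]
  have hE0 : 0 ≤ signAvg n fun x => |∑ j, a j * x j| ^ q :=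
    div_nonneg (Finset.sum_nonneg fun _ _ => by positivity) (by positivity)
  rcases hσ0.eq_or_lt with h0 | h0
  · rw [← h0, mul_zero]
    positivity
  rw [hσ2] at h2 h4
  have pt : ∀ u : ℝ, σ ^ q / 2 * (u ^ 2 / σ ^ 2 - u ^ 4 / (4 * σ ^ 4)) ≤ |u| ^ q := by
    intro u
    set v := |u| / σ with hv
    have hv0 : 0 ≤ v := by positivity
    have hu : |u| = σ * v := by rw [hv]; field_simp
    have e2 : u ^ 2 / σ ^ 2 = v ^ 2 := by rw [← sq_abs, hu]; field_simp
    have e4 : u ^ 4 / (4 * σ ^ 4) = v ^ 4 / 4 := by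
      rw [← (by decide : Even 4).pow_abs u, hu]; field_simp
    rw [e2, e4, hu, Real.mul_rpow h0.le hv0, div_mul_eq_mul_div, mul_div_assoc]
    refine mul_le_mul_of_nonneg_left ?_ (by positivity)
    rcases le_or_gt v 2 with hv2 | hv2
    · rcases le_or_gt v 1 with hv1 | hv1
      · have : v ^ (2 : ℝ) ≤ v ^ q := by
          rcases hv0.eq_or_lt with h | h
          · rw [← h, Real.zero_rpow two_ne_zero]; positivity
          · exact Real.rpow_le_rpow_of_exponent_ge h hv1 hq2
        rw [Real.rpow_two] at this
        nlinarith [sq_nonneg (v ^ 2)]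
      · have : v ^ (1 : ℝ) ≤ v ^ q := Real.rpow_le_rpow_of_exponent_le hv1.le hq1
        rw [Real.rpow_one] at this
        nlinarith [sq_nonneg (v ^ 2)]
    · have : 0 ≤ v ^ q := by positivity
      have h4v : 4 ≤ v ^ 2 := by nlinarith
      nlinarith
  have hm := signAvg_mono (n := n) fun x => pt (∑ j, a j * x j)
  have hl : signAvg n (fun x => σ ^ q / 2 * ((∑ j, a j * x j) ^ 2 / σ ^ 2 -
      (∑ j, a j * x j) ^ 4 / (4 * σ ^ 4))) = σ ^ q / 2 *
      (signAvg n (fun x => (∑ j, a j * x j) ^ 2) / σ ^ 2 -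
        signAvg n (fun x => (∑ j, a j * x j) ^ 4) / (4 * σ ^ 4)) := by
    simp only [signAvg, ← Finset.mul_sum, Finset.sum_sub_distrib, ← Finset.sum_div]
    ring
  have hlow : σ ^ q / 8 ≤ signAvg n fun x => |∑ j, a j * x j| ^ q := by
    refine le_trans ?_ hm
    rw [hl, h2, div_self (by positivity)]
    have : signAvg n (fun x => (∑ j, a j * x j) ^ 4) / (4 * σ ^ 4) ≤ 3 / 4 := by
      rw [div_le_div_iff₀ (by positivity) (by norm_num)]
      nlinarith
    have hs : 0 < σ ^ q := by positivity
    nlinarith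
  calc 1 / 8 * σ ≤ (1 / 8 : ℝ) ^ (1 / q) * σ := by
        refine mul_le_mul_of_nonneg_right ?_ hσ0
        nth_rewrite 1 [← Real.rpow_one (1 / 8 : ℝ)]
        exact Real.rpow_le_rpow_of_exponent_ge (by norm_num) (by norm_num)
          ((div_le_one hq0).2 hq1)
    _ = (σ ^ q / 8) ^ (1 / q) := by
        rw [div_eq_mul_one_div (σ ^ q), mul_comm (σ ^ q), Real.mul_rpow (by norm_num) (by positivity),
          ← Real.rpow_mul hσ0, mul_one_div_cancel hq0.ne', Real.rpow_one]
    _ ≤ _ := Real.rpow_le_rpow (by positivity) hlow (by positivity)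

theorem khinchinA_pos_and_le {q : ℝ} (hq1 : 1 ≤ q) (hq2 : q ≤ 2) :
    0 < khinchinA q ∧ ∀ (n : ℕ) (a : Fin n → ℝ),
      khinchinA q * (∑ j, a j ^ 2) ^ ((1 : ℝ) / 2) ≤
        (signAvg n fun x => |∑ j, a j * x j| ^ q) ^ (1 / q) := by
  have hmem : (1 / 8 : ℝ) ∈ {A : ℝ | 0 < A ∧ ∀ (n : ℕ) (a : Fin n → ℝ),
      A * (∑ j, (a j) ^ 2) ^ ((1 : ℝ) / 2) ≤
        (∫ t in (0 : ℝ)..1, |∑ j, a j * rademacher j t| ^ q) ^ (1 / q)} :=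
    ⟨by norm_num, fun n a => by
      rw [integral_abs_sum_rademacher]; exact signAvg_abs_rpow_ge n a hq1 hq2⟩
  have hbdd : BddAbove {A : ℝ | 0 < A ∧ ∀ (n : ℕ) (a : Fin n → ℝ),
      A * (∑ j, (a j) ^ 2) ^ ((1 : ℝ) / 2) ≤
        (∫ t in (0 : ℝ)..1, |∑ j, a j * rademacher j t| ^ q) ^ (1 / q)} := by
    refine ⟨1, fun A hA => ?_⟩
    have := hA.2 1 fun _ => 1
    rw [integral_abs_sum_rademacher, signAvg_succ] at this
    simpa [signAvg] using this
  refine ⟨lt_of_lt_of_le (by norm_num) (le_csSup hbdd hmem), fun n a => ?_⟩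
  have hσ0 : 0 ≤ (∑ j, a j ^ 2) ^ ((1 : ℝ) / 2) :=
    Real.rpow_nonneg (Finset.sum_nonneg fun j _ => sq_nonneg _) _
  have hE0 : 0 ≤ signAvg n fun x => |∑ j, a j * x j| ^ q :=
    div_nonneg (Finset.sum_nonneg fun _ _ => by positivity) (by positivity)
  rcases hσ0.eq_or_lt with h0 | h0
  · rw [← h0, mul_zero]
    positivity
  · rw [← le_div_iff₀ h0]
    refine csSup_le ⟨_, hmem⟩ fun A hA => ?_
    rw [le_div_iff₀ h0, ← integral_abs_sum_rademacher]
    exact hA.2 n a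

theorem abs_rpow_le_signAvg {n : ℕ} (a : Fin n → ℝ) {q : ℝ} (hq1 : 1 ≤ q) (i : Fin n) :
    |a i| ^ q ≤ signAvg n fun x => |∑ j, a j * x j| ^ q := by
  set S : (Fin n → ℤˣ) → ℝ := fun ε => ∑ j, a j * ((ε j : ℤ) : ℝ) with hS
  set φ : Fin n → ℤˣ := Pi.mulSingle i (-1) with hφ
  have hflip : ∑ ε, |S ε| ^ q = ∑ ε, |S (ε * φ)| ^ q := by
    have h := Equiv.sum_comp (Equiv.mulRight φ)
      fun ε => |S ε| ^ q
    simp only [Equiv.coe_mulRight] at h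
    exact h.symm
  have hdiff : ∀ ε, S ε - S (ε * φ) = 2 * (a i * ((ε i : ℤ) : ℝ)) := by
    intro ε
    simp only [hS, ← Finset.sum_sub_distrib]
    rw [Finset.sum_eq_single i]
    · simp [hφ]; ring
    · intro j _ hj
      simp [hφ, Pi.mulSingle_eq_of_ne hj]
    · simp
  have hunit : ∀ u : ℤˣ, |((u : ℤ) : ℝ)| = 1 := fun u => by
    rcases Int.units_eq_one_or u with rfl | rfl <;> simp
  have hpt : ∀ ε, 2 * |a i| ^ q ≤ |S ε| ^ q + |S (ε * φ)| ^ q := by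
    intro ε
    have h1 : 2 * |a i| ≤ |S ε| + |S (ε * φ)| := by
      have h := abs_sub (S ε) (S (ε * φ))
      rw [hdiff, abs_mul, abs_mul, hunit, abs_two] at h
      linarith
    have h2 := Real.rpow_sum_le_const_mul_sum_rpow (Finset.univ : Finset (Fin 2))
      ![S ε, S (ε * φ)] hq1
    simp only [Fin.sum_univ_two, Matrix.cons_val_zero, Matrix.cons_val_one, Finset.card_univ,
      Fintype.card_fin] at h2
    have h3 := (Real.rpow_le_rpow (by positivity) h1 (by linarith : 0 ≤ q)).trans h2
    rw [Real.mul_rpow two_pos.le (abs_nonneg _), Nat.cast_ofNat,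
      Real.rpow_sub_one two_ne_zero, div_mul_eq_mul_div, mul_div_assoc] at h3
    have := le_of_mul_le_mul_left h3 (by positivity)
    linarith
  have hsum := Finset.sum_le_sum fun ε (_ : ε ∈ Finset.univ) => hpt ε
  rw [Finset.sum_add_distrib, ← hflip, Finset.sum_const, Finset.card_univ, Fintype.card_fun,
    Fintype.card_units_int, Fintype.card_fin, nsmul_eq_mul] at hsum
  push_cast at hsum
  unfold signAvg
  rw [le_div_iff₀ (by positivity)]
  linarith

theorem sum_abs_rpow_le_signAvg {n : ℕ} (a : Fin n → ℝ) {q s : ℝ} (hq1 : 1 ≤ q) (hq2 : q ≤ 2)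
    (hs : 2 ≤ s) :
    (∑ j, |a j| ^ s) ^ (q / s) ≤
      (khinchinA q ^ (-2 / s)) ^ q * signAvg n fun x => |∑ j, a j * x j| ^ q := by
  obtain ⟨hA0, hA⟩ := khinchinA_pos_and_le hq1 hq2
  have hA := hA n a
  have hq0 : 0 < q := by linarith
  have hs0 : 0 < s := by linarith
  have hE0 : 0 ≤ signAvg n fun x => |∑ j, a j * x j| ^ q :=
    div_nonneg (Finset.sum_nonneg fun _ _ => by positivity) (by positivity)
  have hai := abs_rpow_le_signAvg a hq1
  set E := signAvg n fun x => |∑ j, a j * x j| ^ q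
  set M := E ^ (1 / q) with hM
  have hM0 : 0 ≤ M := by positivity
  have hMq : M ^ q = E := by rw [hM, one_div, Real.rpow_inv_rpow hE0 hq0.ne']
  have haM : ∀ i, |a i| ≤ M := fun i => by
    rw [← Real.rpow_le_rpow_iff (abs_nonneg _) hM0 hq0, hMq]; exact hai i
  have h2 : ∑ j, a j ^ 2 ≤ khinchinA q ^ (-2 : ℝ) * M ^ (2 : ℝ) := by
    have h0 : 0 ≤ ∑ j, a j ^ 2 := Finset.sum_nonneg fun j _ => sq_nonneg _
    rw [← Real.sqrt_eq_rpow] at hA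
    have := pow_le_pow_left₀ (by positivity) hA 2
    rw [mul_pow, Real.sq_sqrt h0] at this
    rw [Real.rpow_neg hA0.le, Real.rpow_two, Real.rpow_two, inv_mul_eq_div,
      le_div_iff₀ (by positivity)]
    linarith
  have hsum : ∑ j, |a j| ^ s ≤ khinchinA q ^ (-2 : ℝ) * M ^ s := by
    calc ∑ j, |a j| ^ s ≤ ∑ j, M ^ (s - 2) * a j ^ 2 := by
          refine Finset.sum_le_sum fun j _ => ?_
          have : |a j| ^ s = |a j| ^ (s - 2) * a j ^ 2 := by
            rw [← sq_abs, ← Real.rpow_two, ← Real.rpow_add_of_nonneg (abs_nonneg _)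
              (by linarith) (by norm_num)]
            ring_nf
          rw [this]
          exact mul_le_mul_of_nonneg_right
            (Real.rpow_le_rpow (abs_nonneg _) (haM j) (by linarith)) (sq_nonneg _)
      _ = M ^ (s - 2) * ∑ j, a j ^ 2 := by rw [Finset.mul_sum]
      _ ≤ M ^ (s - 2) * (khinchinA q ^ (-2 : ℝ) * M ^ (2 : ℝ)) :=
          mul_le_mul_of_nonneg_left h2 (by positivity)
      _ = khinchinA q ^ (-2 : ℝ) * M ^ s := by
          have : M ^ s = M ^ (s - 2) * M ^ (2 : ℝ) := by
            rw [← Real.rpow_add_of_nonneg hM0 (by linarith) (by norm_num)]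
            ring_nf
          rw [this]; ring
  refine (Real.rpow_le_rpow (Finset.sum_nonneg fun j _ => by positivity) hsum
    (by positivity : 0 ≤ q / s)).trans_eq ?_
  rw [Real.mul_rpow (by positivity) (by positivity), ← Real.rpow_mul hA0.le,
    ← Real.rpow_mul hM0, ← Real.rpow_mul hA0.le, mul_div_cancel₀ _ hs0.ne', hMq]
  ring_nf

theorem Lp_sum_le_of_nonneg {ι Ω : Type*} [Fintype ι] (W : Finset Ω) (f : Ω → ι → ℝ)
    (hf : ∀ ω j, 0 ≤ f ω j) {r : ℝ} (hr : 1 ≤ r) :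
    (∑ j, (∑ ω ∈ W, f ω j) ^ r) ^ (1 / r) ≤ ∑ ω ∈ W, (∑ j, f ω j ^ r) ^ (1 / r) := by
  classical
  have hr0 : r ≠ 0 := by linarith
  induction W using Finset.induction_on with
  | empty => simp [Real.zero_rpow hr0, Real.zero_rpow (inv_ne_zero hr0)]
  | insert a W ha ih =>
    simp only [Finset.sum_insert ha]
    refine (Real.Lp_add_le_of_nonneg _ hr (fun j _ => hf a j)
      (fun j _ => Finset.sum_nonneg fun ω _ => hf ω j)).trans ?_
    gcongr

theorem sum_abs_rpow_le_multi_signAvg {n : ℕ} {q s : ℝ} (hq1 : 1 ≤ q) (hq2 : q ≤ 2)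
    (hs : 2 ≤ s) (k : ℕ) (a : (Fin k → Fin n) → ℝ) :
    (∑ J, |a J| ^ s) ^ (q / s) ≤ ((khinchinA q ^ (-2 / s)) ^ q / 2 ^ n) ^ k *
      ∑ ε : Fin k → Fin n → ℤˣ, |∑ J, a J * ∏ l, ((ε l (J l) : ℤ) : ℝ)| ^ q := by
  have hA0 := (khinchinA_pos_and_le hq1 hq2).1
  have hq0 : 0 < q := by linarith
  have hs0 : 0 < s := by linarith
  set K := (khinchinA q ^ (-2 / s)) ^ q with hK
  have hK0 : 0 < K := by positivity
  induction k with
  | zero =>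
    simp only [Finset.univ_unique, Finset.sum_singleton, Finset.univ_eq_empty,
      Finset.prod_empty, pow_zero, one_mul, mul_one]
    rw [← Real.rpow_mul (abs_nonneg _), mul_div_cancel₀ _ hs0.ne']
  | succ k ih =>
    have hr : 1 ≤ s / q := (one_le_div hq0).2 (by linarith)
    have hr0 : 0 < s / q := by linarith
    set c : Fin n → (Fin k → Fin n → ℤˣ) → ℝ := fun j ε =>
      ∑ J, a (Fin.cons j J) * ∏ l, ((ε l (J l) : ℤ) : ℝ) with hc
    set κ := (K / 2 ^ n) ^ k with hκ
    have hκ0 : 0 < κ := by positivity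
    have hexp : q / s = 1 / (s / q) := by field_simp
    have h1 : ∑ J, |a J| ^ s ≤ ∑ j, (κ * ∑ ε, |c j ε| ^ q) ^ (s / q) := by
      rw [← (Fin.consEquiv fun _ => Fin n).sum_comp, Fintype.sum_prod_type]
      refine Finset.sum_le_sum fun j _ => ?_
      have h0 : 0 ≤ ∑ J : Fin k → Fin n, |a (Fin.cons j J)| ^ s :=
        Finset.sum_nonneg fun J _ => by positivity
      have := Real.rpow_le_rpow (by positivity) (ih fun J => a (Fin.cons j J)) hr0.le
      rw [← Real.rpow_mul h0] at this
      have e : q / s * (s / q) = 1 := by field_simp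
      rw [e, Real.rpow_one] at this
      exact this
    have h2 : (∑ J, |a J| ^ s) ^ (q / s) ≤ κ * ∑ ε, (∑ j, |c j ε| ^ s) ^ (q / s) := by
      refine (Real.rpow_le_rpow (Finset.sum_nonneg fun J _ => by positivity) h1
        (by positivity)).trans ?_
      rw [hexp]
      have := Lp_sum_le_of_nonneg Finset.univ (fun ε j => |c j ε| ^ q)
        (fun ε j => by positivity) hr
      simp only [Real.mul_rpow hκ0.le (Finset.sum_nonneg fun ε _ =>
        Real.rpow_nonneg (abs_nonneg (c _ ε)) q), ← Finset.mul_sum]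
      rw [Real.mul_rpow (by positivity) (Finset.sum_nonneg fun j _ => Real.rpow_nonneg
        (Finset.sum_nonneg fun ε _ => by positivity) _), one_div, Real.rpow_rpow_inv hκ0.le hr0.ne']
      refine mul_le_mul_of_nonneg_left ?_ hκ0.le
      rw [one_div] at this
      simpa only [← Real.rpow_mul (abs_nonneg _), mul_div_cancel₀ _ hq0.ne'] using this
    refine h2.trans ?_
    have h3 : ∀ ε, (∑ j, |c j ε| ^ s) ^ (q / s) ≤ K / 2 ^ n *
        ∑ δ : Fin n → ℤˣ, |∑ j, c j ε * ((δ j : ℤ) : ℝ)| ^ q := fun ε => by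
      refine (sum_abs_rpow_le_signAvg (fun j => c j ε) hq1 hq2 hs).trans_eq ?_
      rw [signAvg, ← hK]
      ring
    calc κ * ∑ ε, (∑ j, |c j ε| ^ s) ^ (q / s)
        ≤ κ * ∑ ε, K / 2 ^ n * ∑ δ : Fin n → ℤˣ, |∑ j, c j ε * ((δ j : ℤ) : ℝ)| ^ q :=
          mul_le_mul_of_nonneg_left (Finset.sum_le_sum fun ε _ => h3 ε) hκ0.le
      _ = _ := by
          rw [← Finset.mul_sum, ← mul_assoc, hκ, ← pow_succ,
            ← (Fin.consEquiv fun _ => Fin n → ℤˣ).sum_comp, Fintype.sum_prod_type_right]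
          congr 1
          refine Finset.sum_congr rfl fun ε _ => Finset.sum_congr rfl fun δ _ => ?_
          congr 2
          rw [← (Fin.consEquiv fun _ => Fin n).sum_comp, Fintype.sum_prod_type]
          refine Finset.sum_congr rfl fun j _ => ?_
          simp only [hc, Finset.sum_mul]
          refine Finset.sum_congr rfl fun J _ => ?_
          rw [show (Fin.consEquiv fun _ => Fin n) (j, J) = Fin.cons j J from rfl]
          simp [Fin.prod_univ_succ, Fin.consEquiv_apply]
          ring

theorem sum_fiber_insertNth {k n : ℕ} (i : Fin (k + 1)) (t : Fin n)
    (F : (Fin (k + 1) → Fin n) → ℝ) :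
    ∑ j with j i = t, F j = ∑ J : Fin k → Fin n, F (i.insertNth t J) := by
  rw [Finset.sum_filter, ← (Fin.insertNthEquiv (fun _ => Fin n) i).sum_comp,
    Fintype.sum_prod_type_right]
  refine Finset.sum_congr rfl fun J _ => ?_
  simp [Fin.insertNthEquiv]

theorem sum_rpow_le_rpow_sum {ι : Type*} (S : Finset ι) (f : ι → ℝ) (hf : ∀ i, 0 ≤ f i)
    {q : ℝ} (hq : 1 ≤ q) : ∑ i ∈ S, f i ^ q ≤ (∑ i ∈ S, f i) ^ q := by
  classical
  have hq0 : q ≠ 0 := by linarith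
  induction S using Finset.induction_on with
  | empty => simp [Real.zero_rpow hq0]
  | insert a S ha ih =>
    rw [Finset.sum_insert ha, Finset.sum_insert ha]
    have := Real.add_rpow_le_rpow_add (hf a) (Finset.sum_nonneg fun i (_ : i ∈ S) => hf i) hq
    linarith

/-- The mixed-norm inequality for multilinear forms on `ℓ_∞`. -/
theorem sum_fiber_rpow_le_of_signs {k n : ℕ} {q s : ℝ} (hq1 : 1 ≤ q) (hq2 : q ≤ 2) (hs : 2 ≤ s)
    (a : (Fin (k + 1) → Fin n) → ℝ) (C : ℝ)
    (h : ∀ ε : Fin (k + 1) → Fin n → ℤˣ, |∑ j, a j * ∏ l, ((ε l (j l) : ℤ) : ℝ)| ≤ C)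
    (i : Fin (k + 1)) :
    ∑ t, (∑ j with j i = t, |a j| ^ s) ^ (q / s) ≤
      ((khinchinA q ^ (-2 / s)) ^ q) ^ k * C ^ q := by
  have hA0 := (khinchinA_pos_and_le hq1 hq2).1
  set K := (khinchinA q ^ (-2 / s)) ^ q with hK
  have hK0 : 0 < K := by positivity
  set c : Fin n → (Fin k → Fin n → ℤˣ) → ℝ := fun t ε =>
    ∑ J, a (i.insertNth t J) * ∏ l, ((ε l (J l) : ℤ) : ℝ) with hc
  have hsum : ∀ ε, ∑ t, |c t ε| ^ q ≤ C ^ q := by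
    intro ε
    refine (sum_rpow_le_rpow_sum _ _ (fun t => abs_nonneg _) hq1).trans
      (Real.rpow_le_rpow (Finset.sum_nonneg fun t _ => abs_nonneg _) ?_ (by linarith))
    set δ : Fin n → ℤˣ := fun t => if 0 ≤ c t ε then 1 else -1 with hδ
    refine le_trans (Eq.le ?_) ((le_abs_self _).trans (h (i.insertNth δ ε)))
    rw [← (Fin.insertNthEquiv (fun _ => Fin n) i).sum_comp, Fintype.sum_prod_type]
    refine Finset.sum_congr rfl fun t _ => ?_
    have : |c t ε| = c t ε * ((δ t : ℤ) : ℝ) := by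
      simp only [hδ]
      split_ifs with h0
      · simp [abs_of_nonneg h0]
      · simp [abs_of_neg (not_le.1 h0)]
    rw [this, hc, Finset.sum_mul]
    refine Finset.sum_congr rfl fun J _ => ?_
    rw [show (Fin.insertNthEquiv (fun _ => Fin n) i) (t, J) = i.insertNth t J from rfl]
    simp only [Fin.prod_univ_succAbove _ i, Fin.insertNth_apply_same,
      Fin.insertNth_apply_succAbove]
    ring
  calc ∑ t, (∑ j with j i = t, |a j| ^ s) ^ (q / s)
      ≤ ∑ t, (K / 2 ^ n) ^ k * ∑ ε, |c t ε| ^ q := by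
        refine Finset.sum_le_sum fun t _ => ?_
        rw [sum_fiber_insertNth]
        exact sum_abs_rpow_le_multi_signAvg hq1 hq2 hs k _
    _ = (K / 2 ^ n) ^ k * ∑ ε, ∑ t, |c t ε| ^ q := by rw [← Finset.mul_sum, Finset.sum_comm]
    _ ≤ (K / 2 ^ n) ^ k * ∑ _ε : Fin k → Fin n → ℤˣ, C ^ q :=
        mul_le_mul_of_nonneg_left (Finset.sum_le_sum fun ε _ => hsum ε) (by positivity)
    _ = K ^ k * C ^ q := by
        rw [Finset.sum_const, Finset.card_univ, nsmul_eq_mul]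
        simp only [Fintype.card_fun, Fintype.card_units_int, Fintype.card_fin]
        push_cast
        rw [div_pow]
        field_simp

theorem multilinear_apply_eq_sum {m n : ℕ}
    (T : MultilinearMap ℝ (fun _ : Fin m => (Fin n → ℝ)) ℝ) (x : Fin m → Fin n → ℝ) :
    T x = ∑ j : Fin m → Fin n, T (fun i => Pi.single (j i) (1 : ℝ)) * ∏ i, x i (j i) := by
  have hx : x = fun i => ∑ t, x i t • (Pi.single t (1 : ℝ) : Fin n → ℝ) := by
    ext i t
    simp [Finset.sum_apply, Pi.single_apply]
  conv_lhs => rw [hx]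
  rw [T.map_sum]
  refine Finset.sum_congr rfl fun j _ => ?_
  rw [T.map_smul_univ (fun i => x i (j i)), smul_eq_mul, mul_comm]

theorem sum_fiber_rpow_le_of_bound_lt {k n : ℕ} {q s p η : ℝ} (hq1 : 1 ≤ q) (hq2 : q ≤ 2)
    (hs : 2 ≤ s) (hp : 0 < p) (hη : 0 < η) (hsr : 1 / s = 1 / q - k / p)
    (hηr : 1 / η = 1 / s - 1 / p)
    (T : MultilinearMap ℝ (fun _ : Fin (k + 1) => (Fin n → ℝ)) ℝ) (C : ℝ) (hC : 0 < C)
    (hT : ∀ x : Fin (k + 1) → (Fin n → ℝ), (∀ i, ∑ j, |x i j| ^ p ≤ 1) → |T x| ≤ C) :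
    (∑ t, (∑ j : Fin (k + 1) → Fin n with j 0 = t,
      |T fun i => Pi.single (j i) (1 : ℝ)| ^ s) ^ (η / s)) ^ (1 / η) ≤
        (khinchinA q ^ (-2 / s)) ^ k * C := by
  have hA0 := (khinchinA_pos_and_le hq1 hq2).1
  have hq0 : 0 < q := by linarith
  have hs0 : 0 < s := by linarith
  set B := khinchinA q ^ (-2 / s) with hB
  have hB0 : 0 < B := by positivity
  set a : (Fin (k + 1) → Fin n) → ℝ := fun j => T fun i => Pi.single (j i) (1 : ℝ) with ha
  set D := B ^ k * C with hD
  have hD0 : 0 < D := by positivity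
  set V : (Fin (k + 1) → Fin n) → ℝ := fun j => |a j| ^ s / D ^ s with hVdef
  have hV : ∀ j, 0 ≤ V j := fun j => by positivity
  have hπ : 0 < p / s := by positivity
  have H : ∀ w : Fin (k + 1) → Fin n → ℝ, (∀ l t, 0 ≤ w l t) → (∀ l, ∑ t, w l t ^ (p / s) ≤ 1) →
      ∀ i, ∑ t, (∑ j with j i = t, V j * ∏ l, w l (j l)) ^ (1 / (s / q)) ≤ 1 := by
    intro w hw hw1 i
    have hbase := sum_fiber_rpow_le_of_signs hq1 hq2 hs
      (fun j => a j * ∏ l, w l (j l) ^ (1 / s)) C (fun ε => ?_) i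
    · have e : ∀ t, (∑ j with j i = t, V j * ∏ l, w l (j l)) ^ (1 / (s / q)) =
          (∑ j with j i = t, |a j * ∏ l, w l (j l) ^ (1 / s)| ^ s) ^ (q / s) / D ^ q := by
        intro t
        have e1 : ∀ j, V j * ∏ l, w l (j l) = |a j * ∏ l, w l (j l) ^ (1 / s)| ^ s / D ^ s := by
          intro j
          have hp0 : 0 ≤ ∏ l, w l (j l) := Finset.prod_nonneg fun l _ => hw l _
          rw [Real.finsetProd_rpow _ _ fun l _ => hw l _, abs_mul,
            abs_of_nonneg (Real.rpow_nonneg hp0 _), Real.mul_rpow (abs_nonneg _)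
            (Real.rpow_nonneg hp0 _), one_div, Real.rpow_inv_rpow hp0 hs0.ne', hVdef]
          ring
        simp only [e1, ← Finset.sum_div]
        rw [one_div_div, Real.div_rpow (Finset.sum_nonneg fun j _ => by positivity)
          (by positivity), ← Real.rpow_mul hD0.le, mul_div_cancel₀ _ hs0.ne']
      simp only [e, ← Finset.sum_div]
      rw [div_le_one (by positivity)]
      refine hbase.trans_eq ?_
      rw [hD, Real.mul_rpow (by positivity) hC.le, ← Real.rpow_natCast, ← Real.rpow_natCast,
        ← Real.rpow_mul hB0.le, ← Real.rpow_mul hB0.le, mul_comm q]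
    · have e : ∑ j, (a j * ∏ l, w l (j l) ^ (1 / s)) * ∏ l, ((ε l (j l) : ℤ) : ℝ) =
          T fun l t => w l t ^ (1 / s) * ((ε l t : ℤ) : ℝ) := by
        rw [multilinear_apply_eq_sum]
        refine Finset.sum_congr rfl fun j _ => ?_
        rw [Finset.prod_mul_distrib, mul_assoc]
      rw [e]
      refine hT _ fun l => le_trans (Eq.le ?_) (hw1 l)
      refine Finset.sum_congr rfl fun t _ => ?_
      have hu : |((ε l t : ℤ) : ℝ)| = 1 := by
        rcases Int.units_eq_one_or (ε l t) with h | h <;> simp [h]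
      rw [abs_mul, hu, mul_one, abs_of_nonneg (Real.rpow_nonneg (hw l t) _),
        ← Real.rpow_mul (hw l t), one_div_mul_eq_div]
  have hcard : (Finset.univ.erase (0 : Fin (k + 1))).card = k := by simp
  have hone : s / q - k / (p / s) = 1 := by
    have : s / q - k / (p / s) = s * (1 / q - k / p) := by field_simp
    rw [this, ← hsr, mul_one_div_cancel hs0.ne']
  have hfin := sum_fiber_rpow_le_one_of_weights V hV hπ H (Finset.univ.erase 0)
  rw [hcard, hone] at hfin
  have hG : ∑ t, (∑ j with j 0 = t, V j) ^ (η / s) ≤ 1 := by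
    refine sum_rpow_le_one_of_forall_ball (fun t => ∑ j with j 0 = t, V j)
      (fun t => Finset.sum_nonneg fun j _ => hV j) (α := 1) (β := η / s) (π := p / s)
      one_pos (div_pos hη hs0) hπ ?_ fun y hy hy1 => ?_
    · have : 1 / (η / s) = s * (1 / η) := by field_simp
      rw [this, hηr]; field_simp
    · convert hfin le_rfl (Function.update (fun _ _ => 1) 0 y) (fun l t => ?_) (fun l hl => ?_)
        (fun l hl t => ?_) 0 using 2 with t
      · rw [div_one, Real.rpow_one, Real.rpow_one, Finset.sum_mul]
        refine Finset.sum_congr rfl fun j hj => ?_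
        rw [Fin.prod_univ_succ, ← (Finset.mem_filter.1 hj).2]
        simp
      · by_cases h : l = 0
        · subst h; simpa using hy t
        · simp [Function.update_of_ne h]
      · have h : l = 0 := by simpa using hl
        subst h; simpa using hy1
      · rw [Function.update_of_ne (Finset.ne_of_mem_erase hl)]
  have hGe : ∀ t, (∑ j with j 0 = t, V j) ^ (η / s) =
      (∑ j with j 0 = t, |a j| ^ s) ^ (η / s) / D ^ η := fun t => by
    rw [hVdef, ← Finset.sum_div, Real.div_rpow (Finset.sum_nonneg fun j _ => by positivity)
      (by positivity), ← Real.rpow_mul hD0.le, mul_div_cancel₀ _ hs0.ne']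
  simp only [hGe, ← Finset.sum_div] at hG
  rw [div_le_one (by positivity)] at hG
  refine (Real.rpow_le_rpow (Finset.sum_nonneg fun t _ => Real.rpow_nonneg
    (Finset.sum_nonneg fun j _ => by positivity) _) hG (by positivity)).trans_eq ?_
  rw [one_div, Real.rpow_rpow_inv hD0.le hη.ne']

/-- Main theorem: generalized Hardy–Littlewood inequality, one-index version,
with `m = k + 1` (so `m - 1 = k`). -/
theorem stmt12 (k n : ℕ) (hk : 1 ≤ k) (l₀ : ℝ) (hl : l₀ ∈ Set.Icc (1:ℝ) 2)
    (p : ℝ) (hp1 : l₀ * ((k:ℝ) + 1) < p)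
    (hp2 : l₀ = 2 ∨ p ≤ 2 * l₀ * (k:ℝ) / (2 - l₀))
    (s η₁ : ℝ) (hs : s = l₀ * p / (p - l₀ * ((k:ℝ) + 1) + l₀))
    (hη : η₁ = l₀ * p / (p - l₀ * ((k:ℝ) + 1)))
    (T : MultilinearMap ℝ (fun _ : Fin (k + 1) => (Fin n → ℝ)) ℝ)
    (C : ℝ) (hC : 0 ≤ C)
    (hT : ∀ x : Fin (k + 1) → (Fin n → ℝ),
      (∀ i, (∑ j, |x i j| ^ p) ^ (1/p) ≤ 1) → |T x| ≤ C) :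
    (∑ j₁ : Fin n, (∑ J : Fin k → Fin n,
        |T (fun i => Pi.single ((Fin.cons j₁ J : Fin (k + 1) → Fin n) i) (1:ℝ))| ^ s) ^ (η₁ / s))
        ^ (1 / η₁)
      ≤ khinchinA l₀ ^ (-(2 * (k:ℝ)) / s) * C := by
  obtain ⟨hl1, hl2⟩ := hl
  have hl0 : 0 < l₀ := by linarith
  have hk1 : (1 : ℝ) ≤ k := by exact_mod_cast hk
  have hp : 0 < p := lt_trans (by positivity) hp1
  have hd1 : 0 < p - l₀ * ((k : ℝ) + 1) := by linarith
  have hd2 : 0 < p - l₀ * ((k : ℝ) + 1) + l₀ := by linarith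
  have hs2 : 2 ≤ s := by
    rw [hs, le_div_iff₀ hd2]
    rcases hp2 with h | h
    · subst h; nlinarith
    · rcases hl2.eq_or_lt with h2 | h2
      · rw [h2]; nlinarith
      · rw [le_div_iff₀ (by linarith)] at h
        nlinarith
  have hs0 : 0 < s := by linarith
  have hη0 : 0 < η₁ := by rw [hη]; positivity
  have hsr : 1 / s = 1 / l₀ - k / p := by
    rw [hs]; field_simp; ring
  have hηr : 1 / η₁ = 1 / s - 1 / p := by
    rw [hs, hη]; field_simp; ring
  have hA0 := (khinchinA_pos_and_le hl1 hl2).1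
  have hconst : khinchinA l₀ ^ (-(2 * (k : ℝ)) / s) = (khinchinA l₀ ^ (-2 / s)) ^ k := by
    rw [← Real.rpow_natCast, ← Real.rpow_mul hA0.le]
    congr 1
    ring
  rw [hconst]
  have hlhs : ∀ t : Fin n, (∑ J : Fin k → Fin n,
      |T (fun i => Pi.single ((Fin.cons t J : Fin (k + 1) → Fin n) i) (1 : ℝ))| ^ s) =
      ∑ j : Fin (k + 1) → Fin n with j 0 = t, |T fun i => Pi.single (j i) (1 : ℝ)| ^ s := by
    intro t
    rw [sum_fiber_insertNth]
    simp only [Fin.insertNth_zero']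
  simp only [hlhs]
  have hB0 : 0 < (khinchinA l₀ ^ (-2 / s)) ^ k := by positivity
  rw [← div_le_iff₀' hB0]
  refine le_of_forall_gt_imp_ge_of_dense fun C' hC' => ?_
  rw [div_le_iff₀' hB0]
  refine sum_fiber_rpow_le_of_bound_lt hl1 hl2 hs2 hp hη0 hsr hηr T C' (hC.trans_lt hC')
    fun x hx => (hT x fun i => ?_).trans hC'.le
  exact Real.rpow_le_one (Finset.sum_nonneg fun j _ => by positivity) (hx i) (by positivity)
end

section
/- Let m ≥ 2 and m < p ≤ 2m-2. For every m-linear form T : (ℓ_p^n)^m → ℝ and every n, (Σ_{j₁=1}^n (Σ_{j₂,…,j_m=1}^n |T(e_{j₁},…,e_{j_m})|^{p/(p-m+1)})^{((p-m+1)/p)·(p/(p-m))})^{(p-m)/p} ≤ 2^{(m-1)(p-m+1)/p} ‖T‖. -/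
section Auxiliary

open Finset BigOperators

/-- The real sign attached to a Boolean. -/
noncomputable def boolSign (b : Bool) : ℝ := if b then 1 else -1

/-- The Dirichlet form of the random walk on the discrete cube. -/
noncomputable def cubeEnergy (n : ℕ) (f : (Fin n → Bool) → ℝ) : ℝ :=
  (1 / 2) * ∑ i, 𝔼 ε, f ε * (f ε - f (Function.update ε i (!ε i)))

lemma expect_cube_succ (n : ℕ) (f : (Fin (n + 1) → Bool) → ℝ) :
    𝔼 ε, f ε = ((𝔼 ε, f (Fin.cons true ε)) + 𝔼 ε, f (Fin.cons false ε)) / 2 := by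
  rw [← Fintype.expect_equiv (Fin.consEquiv (fun _ : Fin (n + 1) => Bool)) (fun x => f (Fin.cons x.1 x.2)) f
    (fun x => rfl), ← Finset.univ_product_univ, Finset.expect_product]
  simp only [Fintype.expect_eq_sum_div_card, Fintype.sum_bool, Fintype.card_bool]
  norm_num

lemma cubeEnergy_succ (n : ℕ) (f : (Fin (n + 1) → Bool) → ℝ)
    (g h : (Fin n → Bool) → ℝ) (ht : ∀ ε, f (Fin.cons true ε) = g ε + h ε)
    (hf : ∀ ε, f (Fin.cons false ε) = g ε - h ε) :
    cubeEnergy (n + 1) f = cubeEnergy n g + cubeEnergy n h + 𝔼 ε, h ε ^ 2 := by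
  unfold cubeEnergy
  rw [Fin.sum_univ_succ]
  simp only [expect_cube_succ, Fin.cons_zero, Fin.update_cons_zero, Fin.cons_succ,
    ← Fin.cons_update, ht, hf, Bool.not_true, Bool.not_false]
  have h1 : ∀ i : Fin n,
      ((𝔼 ε, (g ε + h ε) * (g ε + h ε - (g (Function.update ε i (!ε i)) +
        h (Function.update ε i (!ε i))))) +
      (𝔼 ε, (g ε - h ε) * (g ε - h ε - (g (Function.update ε i (!ε i)) -
        h (Function.update ε i (!ε i)))))) / 2
      = (𝔼 ε, g ε * (g ε - g (Function.update ε i (!ε i)))) +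
        𝔼 ε, h ε * (h ε - h (Function.update ε i (!ε i))) := by
    intro i
    rw [← expect_add_distrib, ← expect_add_distrib, expect_div]
    refine expect_congr rfl fun ε _ => ?_
    ring
  have h2 : ((𝔼 ε, (g ε + h ε) * (g ε + h ε - (g ε - h ε))) +
      𝔼 ε, (g ε - h ε) * (g ε - h ε - (g ε + h ε))) / 2 = 2 * 𝔼 ε, h ε ^ 2 := by
    rw [← expect_add_distrib, expect_div, mul_expect]
    refine expect_congr rfl fun ε _ => ?_
    ring
  rw [h2, sum_congr rfl fun i _ => h1 i, sum_add_distrib]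
  ring

lemma exists_even_odd_parts (n : ℕ) (f : (Fin (n + 1) → Bool) → ℝ) :
    ∃ g h : (Fin n → Bool) → ℝ, (∀ ε, f (Fin.cons true ε) = g ε + h ε) ∧
      ∀ ε, f (Fin.cons false ε) = g ε - h ε :=
  ⟨fun ε => (f (Fin.cons true ε) + f (Fin.cons false ε)) / 2,
    fun ε => (f (Fin.cons true ε) - f (Fin.cons false ε)) / 2,
    fun ε => by ring, fun ε => by ring⟩

lemma expect_cube_of_parts (n : ℕ) (f : (Fin (n + 1) → Bool) → ℝ)
    (g h : (Fin n → Bool) → ℝ) (ht : ∀ ε, f (Fin.cons true ε) = g ε + h ε)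
    (hf : ∀ ε, f (Fin.cons false ε) = g ε - h ε) :
    𝔼 ε, f ε = 𝔼 ε, g ε := by
  rw [expect_cube_succ, ← expect_add_distrib, expect_div]
  refine expect_congr rfl fun ε _ => ?_
  rw [ht, hf]; ring

lemma expect_sq_cube_of_parts (n : ℕ) (f : (Fin (n + 1) → Bool) → ℝ)
    (g h : (Fin n → Bool) → ℝ) (ht : ∀ ε, f (Fin.cons true ε) = g ε + h ε)
    (hf : ∀ ε, f (Fin.cons false ε) = g ε - h ε) :
    𝔼 ε, f ε ^ 2 = (𝔼 ε, g ε ^ 2) + 𝔼 ε, h ε ^ 2 := by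
  rw [expect_cube_succ, ← expect_add_distrib, ← expect_add_distrib, expect_div]
  refine expect_congr rfl fun ε _ => ?_
  rw [ht, hf]; ring

lemma cube_poincare (n : ℕ) (f : (Fin n → Bool) → ℝ) :
    (𝔼 ε, f ε ^ 2) - (𝔼 ε, f ε) ^ 2 ≤ cubeEnergy n f := by
  induction n with
  | zero => simp [cubeEnergy]
  | succ n ih =>
    obtain ⟨g, h, ht, hf⟩ := exists_even_odd_parts n f
    rw [cubeEnergy_succ n f g h ht hf, expect_cube_of_parts n f g h ht hf,
      expect_sq_cube_of_parts n f g h ht hf]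
    have h1 := ih g
    have h2 : 0 ≤ cubeEnergy n h := by
      refine le_trans ?_ (ih h)
      have := Finset.expect_mul_sq_le_sq_mul_sq univ h (fun _ => (1 : ℝ))
      simpa using this
    linarith

/-- Poincaré inequality beyond the first Walsh level. -/
lemma cube_poincare_two (n : ℕ) (f : (Fin n → Bool) → ℝ) :
    2 * ((𝔼 ε, f ε ^ 2) - (𝔼 ε, f ε) ^ 2) - ∑ i, (𝔼 ε, f ε * boolSign (ε i)) ^ 2
      ≤ cubeEnergy n f := by
  induction n with
  | zero => simp [cubeEnergy]
  | succ n ih =>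
    obtain ⟨g, h, ht, hf⟩ := exists_even_odd_parts n f
    rw [cubeEnergy_succ n f g h ht hf, expect_cube_of_parts n f g h ht hf,
      expect_sq_cube_of_parts n f g h ht hf, Fin.sum_univ_succ]
    have h0 : 𝔼 ε, f ε * boolSign (ε 0) = 𝔼 ε, h ε := by
      refine expect_cube_of_parts n _ h g (fun ε => ?_) (fun ε => ?_)
      · simp [ht, boolSign, add_comm]
      · simp [hf, boolSign]
    have hi : ∀ i : Fin n, 𝔼 ε, f ε * boolSign (ε i.succ) = 𝔼 ε, g ε * boolSign (ε i) := by
      intro i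
      refine expect_cube_of_parts n _ _ (fun ε => h ε * boolSign (ε i)) (fun ε => ?_) (fun ε => ?_)
      · simp [ht, add_mul]
      · simp [hf, sub_mul]
    rw [h0, sum_congr rfl fun i _ => by rw [hi i]]
    linarith [ih g, cube_poincare n h]

lemma expect_sq_rademacher (n : ℕ) (a : Fin n → ℝ) :
    𝔼 ε : Fin n → Bool, (∑ i, a i * boolSign (ε i)) ^ 2 = ∑ i, a i ^ 2 := by
  induction n with
  | zero => simp
  | succ n ih =>
    rw [expect_sq_cube_of_parts n _ (fun ε => ∑ i : Fin n, a i.succ * boolSign (ε i))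
      (fun _ => a 0), ih, Fin.sum_univ_succ]
    · simp [add_comm]
    · intro ε; simp [Fin.sum_univ_succ, boolSign, add_comm]
    · intro ε; simp [Fin.sum_univ_succ, boolSign]; ring

lemma boolSign_true : boolSign true = 1 := rfl

lemma boolSign_false : boolSign false = -1 := rfl

lemma boolSign_not (b : Bool) : boolSign (!b) = -boolSign b := by
  cases b <;> simp [boolSign]

lemma expect_cube_not (n : ℕ) (f : (Fin n → Bool) → ℝ) :
    𝔼 ε : Fin n → Bool, f (fun i => !ε i) = 𝔼 ε, f ε := by
  refine Fintype.expect_equiv (Equiv.arrowCongr (Equiv.refl _) Equiv.boolNot) _ _ fun ε => ?_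
  rfl

/-- Khinchine's inequality between the first and second moments, with the optimal constant. -/
lemma khinchine_sq (n : ℕ) (a : Fin n → ℝ) :
    ∑ i, a i ^ 2 ≤ 2 * (𝔼 ε : Fin n → Bool, |∑ i, a i * boolSign (ε i)|) ^ 2 := by
  set f : (Fin n → Bool) → ℝ := fun ε => |∑ i, a i * boolSign (ε i)| with hf
  have hsq : 𝔼 ε, f ε ^ 2 = ∑ i, a i ^ 2 := by
    simp only [hf, sq_abs]; exact expect_sq_rademacher n a
  have heven : ∀ ε, f (fun i => !ε i) = f ε := by
    intro ε; simp [hf, boolSign_not]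
  have hodd : ∀ i, 𝔼 ε, f ε * boolSign (ε i) = 0 := by
    intro i
    have := expect_cube_not n (fun ε => f ε * boolSign (ε i))
    simp only [heven, boolSign_not, mul_neg, expect_neg_distrib] at this
    linarith
  have hflip : ∀ ε, ∑ i, (f ε - f (Function.update ε i (!ε i))) ≤ 2 * f ε := by
    intro ε
    have h1 : ∀ i, ∑ j, a j * boolSign (Function.update ε i (!ε i) j)
        = (∑ j, a j * boolSign (ε j)) - 2 * (a i * boolSign (ε i)) := by
      intro i
      rw [eq_sub_iff_add_eq, ← Finset.sum_erase_add univ _ (mem_univ i),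
        ← Finset.sum_erase_add univ (fun j => a j * boolSign (ε j)) (mem_univ i)]
      rw [Finset.sum_congr rfl (g := fun j => a j * boolSign (ε j)) fun j hj => by
        rw [Function.update_of_ne (ne_of_mem_erase hj)]]
      rw [Function.update_self, boolSign_not]; ring
    have h2 : |∑ i, ∑ j, a j * boolSign (Function.update ε i (!ε i) j)|
        ≤ ∑ i, f (Function.update ε i (!ε i)) := abs_sum_le_sum_abs _ _
    simp only [h1, sum_sub_distrib, ← mul_sum, sum_const, card_univ, Fintype.card_fin,
      nsmul_eq_mul] at h2 ⊢
    rw [← sub_mul, abs_mul] at h2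
    have h3 := mul_le_mul_of_nonneg_right (le_abs_self ((n : ℝ) - 2))
      (abs_nonneg (∑ j, a j * boolSign (ε j)))
    have : f ε = |∑ j, a j * boolSign (ε j)| := rfl
    rw [this]
    linarith
  have hen : cubeEnergy n f ≤ 𝔼 ε, f ε ^ 2 := by
    unfold cubeEnergy
    rw [← expect_sum_comm, mul_expect]
    refine expect_le_expect fun ε _ => ?_
    rw [← mul_sum]
    have := mul_le_mul_of_nonneg_left (hflip ε) (abs_nonneg _ : 0 ≤ f ε)
    linarith
  have := cube_poincare_two n f
  simp only [hodd] at this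
  rw [← hsq]
  simp at this
  linarith

lemma abs_le_expect_rademacher (n : ℕ) (a : Fin n → ℝ) (i : Fin n) :
    |a i| ≤ 𝔼 ε : Fin n → Bool, |∑ i, a i * boolSign (ε i)| := by
  induction n with
  | zero => exact i.elim0
  | succ n ih =>
    rw [expect_cube_succ, ← expect_add_distrib, expect_div]
    simp only [Fin.sum_univ_succ, Fin.cons_zero, Fin.cons_succ, boolSign_true, boolSign_false, mul_one, mul_neg]
    refine Fin.cases ?_ (fun i => ?_) i
    · rw [← Fintype.expect_const (ι := Fin n → Bool) (|a 0|)]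
      refine expect_le_expect fun ε _ => ?_
      have := abs_sub (a 0 + ∑ i : Fin n, a i.succ * boolSign (ε i))
        (-a 0 + ∑ i : Fin n, a i.succ * boolSign (ε i))
      have h2 : a 0 + ∑ i : Fin n, a i.succ * boolSign (ε i) -
        (-a 0 + ∑ i : Fin n, a i.succ * boolSign (ε i)) = 2 * a 0 := by ring
      rw [h2, abs_mul, abs_two] at this
      linarith
    · refine (ih (fun i => a i.succ) i).trans (expect_le_expect fun ε _ => ?_)
      have := abs_add_le (a 0 + ∑ i : Fin n, a i.succ * boolSign (ε i))
        (-a 0 + ∑ i : Fin n, a i.succ * boolSign (ε i))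
      have h2 : a 0 + ∑ i : Fin n, a i.succ * boolSign (ε i) +
        (-a 0 + ∑ i : Fin n, a i.succ * boolSign (ε i)) =
          2 * ∑ i : Fin n, a i.succ * boolSign (ε i) := by ring
      rw [h2, abs_mul, abs_two] at this
      linarith

/-- Khinchine's inequality comparing an `ℓ_s` norm, `2 ≤ s`, with the first moment. -/
lemma khinchine_rpow (n : ℕ) (a : Fin n → ℝ) {s : ℝ} (hs : 2 ≤ s) :
    ∑ i, |a i| ^ s ≤ 2 * (𝔼 ε : Fin n → Bool, |∑ i, a i * boolSign (ε i)|) ^ s := by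
  set E := 𝔼 ε : Fin n → Bool, |∑ i, a i * boolSign (ε i)| with hE
  have hE0 : 0 ≤ E := expect_nonneg fun _ _ => abs_nonneg _
  have split : ∀ x : ℝ, 0 ≤ x → x ^ s = x ^ 2 * x ^ (s - 2) := by
    intro x hx
    rw [← Real.rpow_natCast x 2, ← Real.rpow_add_of_nonneg hx (by norm_num) (by linarith)]
    congr 1; push_cast; ring
  calc ∑ i, |a i| ^ s ≤ ∑ i, a i ^ 2 * E ^ (s - 2) := by
        refine sum_le_sum fun i _ => ?_
        rw [split _ (abs_nonneg _), sq_abs]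
        have := abs_le_expect_rademacher n a i
        gcongr
    _ ≤ 2 * E ^ 2 * E ^ (s - 2) := by
        rw [← sum_mul]
        exact mul_le_mul_of_nonneg_right (khinchine_sq n a) (Real.rpow_nonneg hE0 _)
    _ = 2 * E ^ s := by rw [split E hE0]; ring

lemma minkowski_sum {Ω κ : Type*} [Fintype κ] (t : Finset Ω) (g : Ω → κ → ℝ)
    (hg : ∀ ω j, 0 ≤ g ω j) {s : ℝ} (hs : 1 ≤ s) :
    (∑ j, (∑ ω ∈ t, g ω j) ^ s) ^ (1 / s) ≤ ∑ ω ∈ t, (∑ j, g ω j ^ s) ^ (1 / s) := by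
  classical
  induction t using Finset.induction_on with
  | empty =>
    have : s ≠ 0 := by linarith
    simp [Real.zero_rpow, this]
  | insert ω t hω ih =>
    simp only [sum_insert hω]
    refine (Real.Lp_add_le_of_nonneg univ hs (fun j _ => hg ω j)
      (fun j _ => sum_nonneg fun ω _ => hg ω j)).trans ?_
    gcongr

lemma minkowski_expect {Ω κ : Type*} [Fintype κ] [Fintype Ω] (g : Ω → κ → ℝ)
    (hg : ∀ ω j, 0 ≤ g ω j) {s : ℝ} (hs : 1 ≤ s) :
    ∑ j, (𝔼 ω, g ω j) ^ s ≤ (𝔼 ω, (∑ j, g ω j ^ s) ^ (1 / s)) ^ s := by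
  have hs0 : 0 < s := by linarith
  have h := minkowski_sum univ g hg hs
  simp only [Fintype.expect_eq_sum_div_card]
  rw [sum_congr rfl fun j _ => Real.div_rpow (sum_nonneg fun ω _ => hg ω j) (by positivity) s,
    ← sum_div, Real.div_rpow (sum_nonneg fun ω _ => Real.rpow_nonneg
      (sum_nonneg fun j _ => Real.rpow_nonneg (hg ω j) _) _) (by positivity)]
  gcongr
  have h0 : 0 ≤ ∑ j, (∑ ω, g ω j) ^ s :=
    sum_nonneg fun j _ => Real.rpow_nonneg (sum_nonneg fun ω _ => hg ω j) _
  calc _ = ((∑ j, (∑ ω, g ω j) ^ s) ^ (1 / s)) ^ s := by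
        rw [← Real.rpow_mul h0, one_div_mul_cancel hs0.ne', Real.rpow_one]
    _ ≤ _ := by gcongr

lemma sum_insertNth {k : ℕ} {A : Type*} [Fintype A] (d : Fin (k + 1))
    (f : (Fin (k + 1) → A) → ℝ) :
    ∑ J, f J = ∑ a, ∑ J : Fin k → A, f (d.insertNth a J) := by
  rw [← (Fin.insertNthEquiv (fun _ : Fin (k + 1) => A) d).sum_comp, Fintype.sum_prod_type]
  rfl

lemma expect_insertNth {k : ℕ} {A : Type*} [Fintype A] (d : Fin (k + 1))
    (f : (Fin (k + 1) → A) → ℝ) :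
    𝔼 J, f J = 𝔼 J : Fin k → A, 𝔼 a, f (d.insertNth a J) := by
  rw [expect_comm, ← Fintype.expect_equiv (Fin.insertNthEquiv (fun _ : Fin (k + 1) => A) d)
    (fun x => f (d.insertNth x.1 x.2)) f (fun x => rfl), ← Finset.univ_product_univ,
    Finset.expect_product]

lemma single_insertNth {k n : ℕ} (d : Fin (k + 1)) (j : Fin n) (J : Fin k → Fin n) :
    (fun i => Pi.single ((d.insertNth j J : Fin (k + 1) → Fin n) i) (1 : ℝ)) =
      (d.insertNth (Pi.single j (1 : ℝ)) (fun i => Pi.single (J i) (1 : ℝ)) :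
        Fin (k + 1) → Fin n → ℝ) := by
  rw [Fin.eq_insertNth_iff]
  constructor
  · simp
  · ext; simp [Fin.removeNth]

lemma boolSign_insertNth {k n : ℕ} (d : Fin (k + 1)) (δ : Fin n → Bool)
    (ε : Fin k → Fin n → Bool) :
    (fun i j => boolSign ((d.insertNth δ ε : Fin (k + 1) → Fin n → Bool) i j)) =
      (d.insertNth (fun j => boolSign (δ j)) (fun i j => boolSign (ε i j)) :
        Fin (k + 1) → Fin n → ℝ) := by
  rw [Fin.eq_insertNth_iff]
  constructor
  · simp
  · ext; simp [Fin.removeNth]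

lemma map_insertNth_eq_sum {k n : ℕ} (T : MultilinearMap ℝ (fun _ : Fin (k + 1) => (Fin n → ℝ)) ℝ)
    (d : Fin (k + 1)) (x : Fin n → ℝ) (y : Fin k → Fin n → ℝ) :
    T (d.insertNth x y) = ∑ j, T (d.insertNth (Pi.single j (1 : ℝ)) y) * x j := by
  have h := congrArg (fun g => g y) ((T.curryMid d).pi_apply_eq_sum_univ x)
  simp only [MultilinearMap.curryMid_apply_apply, _root_.sum_apply,
    _root_.smul_apply, smul_eq_mul] at h
  rw [h]
  refine sum_congr rfl fun j _ => ?_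
  rw [mul_comm]
  congr 3
  ext i
  simp [Pi.single_apply, eq_comm]

/-- Multilinear Khinchine inequality. -/
lemma multilinear_khinchine (k n : ℕ) (T : MultilinearMap ℝ (fun _ : Fin k => (Fin n → ℝ)) ℝ)
    {s : ℝ} (hs : 2 ≤ s) :
    ∑ J : Fin k → Fin n, |T (fun i => Pi.single (J i) (1 : ℝ))| ^ s ≤
      2 ^ k * (𝔼 ε : Fin k → Fin n → Bool, |T (fun i j => boolSign (ε i j))|) ^ s := by
  induction k with
  | zero =>
    have h : ∀ x y : Fin 0 → Fin n → ℝ, T x = T y := fun x y => by rw [Subsingleton.elim x y]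
    simp [h _ 0]
  | succ k ih =>
    have hs0 : 0 < s := by linarith
    rw [sum_insertNth 0, expect_insertNth 0]
    simp only [single_insertNth, boolSign_insertNth]
    calc _ ≤ ∑ j : Fin n, 2 ^ k * (𝔼 ε : Fin k → Fin n → Bool,
          |T (Fin.insertNth 0 (Pi.single j (1 : ℝ)) (fun i j => boolSign (ε i j)))|) ^ s :=
          sum_le_sum fun j _ => ih (T.curryMid 0 (Pi.single j 1))
      _ ≤ 2 ^ k * (𝔼 ε : Fin k → Fin n → Bool, (∑ j,
          |T (Fin.insertNth 0 (Pi.single j (1 : ℝ)) (fun i j => boolSign (ε i j)))| ^ s)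
            ^ (1 / s)) ^ s := by
          rw [← mul_sum]
          gcongr
          exact minkowski_expect _ (fun _ _ => abs_nonneg _) (by linarith)
      _ ≤ 2 ^ k * (𝔼 ε : Fin k → Fin n → Bool, 2 ^ (1 / s) * 𝔼 δ : Fin n → Bool,
          |T (Fin.insertNth 0 (fun j => boolSign (δ j)) (fun i j => boolSign (ε i j)))|) ^ s := by
          have h0 : ∀ ε : Fin k → Fin n → Bool, 0 ≤ ∑ j,
              |T (Fin.insertNth 0 (Pi.single j (1 : ℝ)) (fun i j => boolSign (ε i j)))| ^ s :=
            fun ε => sum_nonneg fun j _ => Real.rpow_nonneg (abs_nonneg _) _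
          refine mul_le_mul_of_nonneg_left (Real.rpow_le_rpow (expect_nonneg fun ε _ =>
            Real.rpow_nonneg (h0 ε) _) (expect_le_expect fun ε _ => ?_) hs0.le) (by positivity)
          have h := khinchine_rpow n
            (fun j => T (Fin.insertNth 0 (Pi.single j (1 : ℝ)) (fun i j => boolSign (ε i j)))) hs
          simp only [← map_insertNth_eq_sum T 0 (fun j => boolSign _)] at h
          refine (Real.rpow_le_rpow (h0 ε) h (by positivity)).trans_eq ?_
          have h1 : 0 ≤ 𝔼 δ : Fin n → Bool,
              |T (Fin.insertNth 0 (fun j => boolSign (δ j)) (fun i j => boolSign (ε i j)))| :=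
            expect_nonneg fun _ _ => abs_nonneg _
          rw [Real.mul_rpow (by norm_num) (Real.rpow_nonneg h1 _), ← Real.rpow_mul h1,
            mul_one_div_cancel hs0.ne', Real.rpow_one]
      _ = _ := by
          rw [← mul_expect, Real.mul_rpow (by positivity)
            (expect_nonneg fun _ _ => expect_nonneg fun _ _ => abs_nonneg _),
            ← Real.rpow_mul (by norm_num), one_div_mul_cancel hs0.ne', Real.rpow_one]
          ring

lemma sum_filter_insertNth {k : ℕ} {A : Type*} [Fintype A] [DecidableEq A] (d : Fin (k + 1))
    (f : (Fin (k + 1) → A) → ℝ) (a : A) :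
    ∑ J with J d = a, f J = ∑ J : Fin k → A, f (d.insertNth a J) := by
  rw [sum_filter, sum_insertNth d]
  simp only [Fin.insertNth_apply_same]
  rw [Finset.sum_eq_single a]
  · simp
  · intro b _ hb; simp [hb]
  · simp

/-- Mixed `(ℓ_1, ℓ_s)` Littlewood inequality for forms bounded on products of cubes. -/
lemma mixed_littlewood (k n : ℕ) (T : MultilinearMap ℝ (fun _ : Fin (k + 1) => (Fin n → ℝ)) ℝ)
    {s C : ℝ} (hs : 2 ≤ s) (hT : ∀ x : Fin (k + 1) → Fin n → ℝ, (∀ i j, |x i j| ≤ 1) → |T x| ≤ C)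
    (d : Fin (k + 1)) :
    ∑ j, (∑ J : Fin (k + 1) → Fin n with J d = j,
      |T (fun i => Pi.single (J i) (1 : ℝ))| ^ s) ^ (1 / s) ≤ 2 ^ ((k : ℝ) / s) * C := by
  have hs0 : 0 < s := by linarith
  have hsign : ∀ b, |boolSign b| ≤ 1 := by intro b; cases b <;> simp [boolSign]
  calc _ ≤ ∑ j : Fin n, 2 ^ ((k : ℝ) / s) * 𝔼 ε : Fin k → Fin n → Bool,
        |T (d.insertNth (Pi.single j (1 : ℝ)) (fun i j => boolSign (ε i j)))| := by
        refine sum_le_sum fun j _ => ?_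
        rw [sum_filter_insertNth]
        simp only [single_insertNth]
        have h := multilinear_khinchine k n (T.curryMid d (Pi.single j 1)) hs
        simp only [MultilinearMap.curryMid_apply_apply] at h
        refine (Real.rpow_le_rpow (sum_nonneg fun j _ => Real.rpow_nonneg (abs_nonneg _) _) h
          (by positivity)).trans_eq ?_
        have h1 : 0 ≤ 𝔼 ε : Fin k → Fin n → Bool,
            |T (d.insertNth (Pi.single j (1 : ℝ)) (fun i j => boolSign (ε i j)))| :=
          expect_nonneg fun _ _ => abs_nonneg _
        rw [Real.mul_rpow (by positivity) (Real.rpow_nonneg h1 _), ← Real.rpow_mul h1,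
            mul_one_div_cancel hs0.ne', Real.rpow_one, ← Real.rpow_natCast,
            ← Real.rpow_mul (by norm_num), mul_one_div]
    _ = 2 ^ ((k : ℝ) / s) * 𝔼 ε : Fin k → Fin n → Bool, ∑ j,
        |T (d.insertNth (Pi.single j (1 : ℝ)) (fun i j => boolSign (ε i j)))| := by
        rw [← mul_sum, expect_sum_comm]
    _ ≤ _ := by
        refine mul_le_mul_of_nonneg_left ?_ (by positivity)
        rw [← Fintype.expect_const (ι := Fin k → Fin n → Bool) C]
        refine expect_le_expect fun ε _ => ?_
        have h := map_insertNth_eq_sum T d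
          (fun j => (SignType.sign (T (d.insertNth (Pi.single j (1 : ℝ))
            (fun i j => boolSign (ε i j)))) : ℝ)) (fun i j => boolSign (ε i j))
        simp only [self_mul_sign] at h
        rw [← h]
        refine (le_abs_self _).trans (hT _ fun i => ?_)
        induction i using d.succAboveCases with
        | x =>
          intro j
          rw [Fin.insertNth_apply_same]
          generalize T _ = t
          rcases lt_trichotomy t 0 with h | h | h <;> simp [h]
        | p i =>
          intro j
          rw [Fin.insertNth_apply_succAbove]
          exact hsign _

/-- Interpolation of mixed inequalities: a probability weight `α` on a product, rescaled by powers
of its own marginals, cannot have all its mixed `(ℓ_1, ℓ_s)` norms below one. -/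
lemma one_le_of_marginal_bounds {ι κ : Type*} [Fintype ι] [DecidableEq ι] [Fintype κ]
    [DecidableEq κ] (S : Finset ι) (hS : S.Nonempty) (α : (ι → κ) → ℝ) (hα : ∀ J, 0 ≤ α J)
    (hα1 : ∑ J, α J = 1) (μ : ι → κ → ℝ) (hμ : ∀ i j, μ i j = ∑ J with J i = j, α J)
    {s p L : ℝ} (hs : 1 ≤ s) (hp : 0 < p) (hsp : 1 - 1 / s = S.card / p)
    (hL : ∀ d ∈ S, ∑ j, (∑ J with J d = j, α J * ∏ i ∈ S, μ i (J i) ^ (s / p)) ^ (1 / s) ≤ L) :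
    1 ≤ L := by
  have hs0 : 0 < s := by linarith
  have hc : (0 : ℝ) < S.card := by exact_mod_cast hS.card_pos
  have hμ0 : ∀ i j, 0 ≤ μ i j := fun i j => by rw [hμ]; exact sum_nonneg fun J _ => hα J
  have hαμ : ∀ i J, α J ≤ μ i (J i) := fun i J => by
    rw [hμ]
    exact single_le_sum (f := α) (fun J _ => hα J) (by simp)
  have hd : ∀ d ∈ S, ∑ J, α J * (μ d (J d) ^ (-(S.card / p)) * ∏ i ∈ S, μ i (J i) ^ (1 / p))
      ≤ L := by
    intro d hdS
    refine le_trans ?_ (hL d hdS)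
    rw [← Finset.sum_fiberwise univ (fun J : ι → κ => J d)]
    refine sum_le_sum fun j _ => ?_
    have h := Real.inner_le_weight_mul_Lp_of_nonneg ({J | J d = j} : Finset (ι → κ)) hs α
      (fun J => ∏ i ∈ S, μ i (J i) ^ (1 / p)) hα
      (fun J => prod_nonneg fun i _ => Real.rpow_nonneg (hμ0 _ _) _)
    have e : ∀ J : ι → κ, (∏ i ∈ S, μ i (J i) ^ (1 / p)) ^ s = ∏ i ∈ S, μ i (J i) ^ (s / p) := by
      intro J
      rw [← Real.finsetProd_rpow _ _ fun i _ => Real.rpow_nonneg (hμ0 _ _) _]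
      refine prod_congr rfl fun i _ => ?_
      rw [← Real.rpow_mul (hμ0 _ _)]; congr 1; ring
    simp only [e] at h
    rw [← hμ, ← one_div] at h
    have hX : 0 ≤ (∑ J with J d = j, α J * ∏ i ∈ S, μ i (J i) ^ (s / p)) ^ (1 / s) :=
      Real.rpow_nonneg (sum_nonneg fun J _ => mul_nonneg (hα J)
        (prod_nonneg fun i _ => Real.rpow_nonneg (hμ0 _ _) _)) _
    calc _ = μ d j ^ (-(S.card / p)) * ∑ J with J d = j, α J * ∏ i ∈ S, μ i (J i) ^ (1 / p) := by
          rw [mul_sum]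
          refine sum_congr rfl fun J hJ => ?_
          rw [(mem_filter.1 hJ).2]; ring
      _ ≤ μ d j ^ (-(S.card / p)) * (μ d j ^ (S.card / p) * _) := by
          rw [← hsp]
          exact mul_le_mul_of_nonneg_left h (Real.rpow_nonneg (hμ0 _ _) _)
      _ ≤ 1 * _ := by
          rw [← mul_assoc]
          refine mul_le_mul_of_nonneg_right ?_ hX
          rw [Real.rpow_neg (hμ0 _ _)]
          exact inv_mul_le_one
      _ = _ := one_mul _
  have hJ : ∀ J, α J ≤ ∑ d ∈ S, (1 / S.card : ℝ) *
      (α J * (μ d (J d) ^ (-(S.card / p)) * ∏ i ∈ S, μ i (J i) ^ (1 / p))) := by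
    intro J
    rcases (hα J).eq_or_lt with h0 | h0
    · simp [← h0]
    have hpos : ∀ i, 0 < μ i (J i) := fun i => h0.trans_le (hαμ i J)
    have h := Real.geom_mean_le_arith_mean_weighted S (fun _ => (1 / S.card : ℝ))
      (fun d => μ d (J d) ^ (-(S.card / p))) (fun _ _ => by positivity)
      (by rw [sum_const, nsmul_eq_mul]; field_simp) (fun d _ => (Real.rpow_pos_of_pos (hpos d) _).le)
    have e : ∏ d ∈ S, (μ d (J d) ^ (-(S.card / p))) ^ (1 / S.card : ℝ) =
        (∏ d ∈ S, μ d (J d) ^ (1 / p))⁻¹ := by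
      rw [← prod_inv_distrib]
      refine prod_congr rfl fun d _ => ?_
      rw [← Real.rpow_mul (hpos d).le, ← Real.rpow_neg (hpos d).le]
      congr 1; field_simp
    rw [e] at h
    have hP : 0 < ∏ d ∈ S, μ d (J d) ^ (1 / p) :=
      prod_pos fun d _ => Real.rpow_pos_of_pos (hpos d) _
    rw [inv_le_iff_one_le_mul₀ hP] at h
    calc α J = α J * 1 := (mul_one _).symm
      _ ≤ α J * _ := mul_le_mul_of_nonneg_left h h0.le
      _ = _ := by
        rw [sum_mul, mul_sum]
        refine sum_congr rfl fun d _ => ?_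
        ring
  calc 1 = ∑ J, α J := hα1.symm
    _ ≤ _ := sum_le_sum fun J _ => hJ J
    _ = ∑ d ∈ S, (1 / S.card : ℝ) * ∑ J, α J *
        (μ d (J d) ^ (-(S.card / p)) * ∏ i ∈ S, μ i (J i) ^ (1 / p)) := by
        rw [sum_comm]; simp only [mul_sum]
    _ ≤ ∑ d ∈ S, (1 / S.card : ℝ) * L :=
        sum_le_sum fun d hdS => mul_le_mul_of_nonneg_left (hd d hdS) (by positivity)
    _ = L := by rw [sum_const, nsmul_eq_mul]; field_simp

/-- The mixed Littlewood inequality after rescaling by points of the unit ball of `ℓ_p`. -/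
lemma mixed_littlewood_weighted (k n : ℕ)
    (T : MultilinearMap ℝ (fun _ : Fin (k + 1) => (Fin n → ℝ)) ℝ) {s p C : ℝ} (hs : 2 ≤ s)
    (hp : 0 < p)
    (hT : ∀ x : Fin (k + 1) → (Fin n → ℝ),
      (∀ i, (∑ j, |x i j| ^ p) ^ (1 / p) ≤ 1) → |T x| ≤ C)
    (μ : Fin (k + 1) → Fin n → ℝ) (hμ0 : ∀ i j, 0 ≤ μ i j) (hμ1 : ∀ i, ∑ j, μ i j = 1)
    (d : Fin (k + 1)) :
    ∑ j, (∑ J : Fin (k + 1) → Fin n with J d = j,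
      |T (fun i => Pi.single (J i) (1 : ℝ))| ^ s * ∏ i, μ i (J i) ^ (s / p)) ^ (1 / s)
      ≤ 2 ^ ((k : ℝ) / s) * C := by
  have h := mixed_littlewood k n (T.compLinearMap fun i =>
    LinearMap.pi fun j => (μ i j ^ (1 / p)) • LinearMap.proj j) (C := C) hs ?_ d
  · refine le_of_eq_of_le ?_ h
    refine sum_congr rfl fun j _ => ?_
    congr 1
    refine sum_congr rfl fun J _ => ?_
    have e : (fun i => (LinearMap.pi fun j => (μ i j ^ (1 / p)) • LinearMap.proj j :
        (Fin n → ℝ) →ₗ[ℝ] (Fin n → ℝ)) (Pi.single (J i) (1 : ℝ))) =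
        fun i => (μ i (J i) ^ (1 / p)) • (Pi.single (J i) (1 : ℝ) : Fin n → ℝ) := by
      ext i j
      by_cases hj : j = J i
      · subst hj; simp
      · simp [hj]
    rw [MultilinearMap.compLinearMap_apply, e, T.map_smul_univ, smul_eq_mul, abs_mul,
      Real.mul_rpow (abs_nonneg _) (abs_nonneg _), mul_comm,
      abs_of_nonneg (prod_nonneg fun i _ => Real.rpow_nonneg (hμ0 _ _) _),
      ← Real.finsetProd_rpow _ _ fun i _ => Real.rpow_nonneg (hμ0 _ _) _]
    congr 1
    refine prod_congr rfl fun i _ => ?_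
    rw [← Real.rpow_mul (hμ0 _ _)]; congr 1; ring
  · intro x hx
    rw [MultilinearMap.compLinearMap_apply]
    refine hT _ fun i => Real.rpow_le_one (sum_nonneg fun j _ =>
      Real.rpow_nonneg (abs_nonneg _) _) ?_ (by positivity)
    refine (sum_le_sum fun j _ => ?_).trans_eq (hμ1 i)
    simp only [LinearMap.pi_apply, LinearMap.smul_apply, LinearMap.proj_apply, smul_eq_mul]
    have h1 : |μ i j ^ (1 / p) * x i j| ≤ μ i j ^ (1 / p) := by
      rw [abs_mul, abs_of_nonneg (Real.rpow_nonneg (hμ0 _ _) _)]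
      exact mul_le_of_le_one_right (Real.rpow_nonneg (hμ0 _ _) _) (hx i j)
    refine (Real.rpow_le_rpow (abs_nonneg _) h1 hp.le).trans_eq ?_
    rw [← Real.rpow_mul (hμ0 _ _), one_div_mul_cancel hp.ne', Real.rpow_one]

set_option maxHeartbeats 1000000 in
/-- The Hardy–Littlewood inequality with outer exponent `l` and inner exponent `s`. -/
lemma hardy_littlewood_mixed (k n : ℕ) (hk : 1 ≤ k)
    (T : MultilinearMap ℝ (fun _ : Fin (k + 1) => (Fin n → ℝ)) ℝ) {s l p C : ℝ} (hs : 2 ≤ s)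
    (hl : 0 < l) (hp : 0 < p) (hsp : 1 - 1 / s = k / p) (hlsp : 1 / s - 1 / l = 1 / p)
    (hC : 0 ≤ C)
    (hT : ∀ x : Fin (k + 1) → (Fin n → ℝ),
      (∀ i, (∑ j, |x i j| ^ p) ^ (1 / p) ≤ 1) → |T x| ≤ C) :
    (∑ j, (∑ J : Fin (k + 1) → Fin n with J 0 = j,
      |T (fun i => Pi.single (J i) (1 : ℝ))| ^ s) ^ (l / s)) ^ (1 / l)
      ≤ 2 ^ ((k : ℝ) / s) * C := by
  have hs0 : 0 < s := by linarith
  set t : (Fin (k + 1) → Fin n) → ℝ := fun J => |T (fun i => Pi.single (J i) (1 : ℝ))| ^ s with ht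
  have ht0 : ∀ J, 0 ≤ t J := fun J => Real.rpow_nonneg (abs_nonneg _) _
  set B : Fin n → ℝ := fun j => ∑ J with J 0 = j, t J with hB
  have hB0 : ∀ j, 0 ≤ B j := fun j => sum_nonneg fun J _ => ht0 J
  set Z : ℝ := ∑ j, B j ^ (l / s) with hZ
  have hZ0 : 0 ≤ Z := sum_nonneg fun j _ => Real.rpow_nonneg (hB0 j) _
  change Z ^ (1 / l) ≤ _
  rcases hZ0.eq_or_lt with h0 | hZpos
  · rw [← h0, Real.zero_rpow (by positivity)]; positivity
  have hls : l / s - 1 = l / p := by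
    have : l * (1 / s - 1 / l) = l * (1 / p) := by rw [hlsp]
    rw [mul_sub, mul_one_div_cancel hl.ne'] at this
    linarith [mul_one_div l s, mul_one_div l p]
  have hBpow : ∀ j, B j * B j ^ (l / p) = B j ^ (l / s) := by
    intro j
    rw [← Real.rpow_one_add' (hB0 j) (by positivity)]
    congr 1; linarith
  set α : (Fin (k + 1) → Fin n) → ℝ := fun J => t J * B (J 0) ^ (l / p) / Z with hα
  have hα0 : ∀ J, 0 ≤ α J := fun J =>
    div_nonneg (mul_nonneg (ht0 J) (Real.rpow_nonneg (hB0 _) _)) hZ0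
  set μ : Fin (k + 1) → Fin n → ℝ := fun i j => ∑ J with J i = j, α J with hμ
  have hμ0 : ∀ i j, 0 ≤ μ i j := fun i j => sum_nonneg fun J _ => hα0 J
  have hμz : ∀ j, μ 0 j = B j ^ (l / s) / Z := by
    intro j
    rw [← hBpow, hB, sum_mul, sum_div]
    refine sum_congr rfl fun J hJ => ?_
    rw [← (mem_filter.1 hJ).2]
  have hsum : ∀ i, ∑ j, μ i j = ∑ J, α J := fun i => sum_fiberwise univ (fun J => J i) α
  have hα1 : ∑ J, α J = 1 := by
    rw [← hsum 0, sum_congr rfl fun j _ => hμz j, ← sum_div, ← hZ, div_self hZpos.ne']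
  have hα_eq : ∀ J, t J * μ 0 (J 0) ^ (s / p) = Z ^ (s / l) * α J := by
    intro J
    have e1 : l / s * (s / p) = l / p := by field_simp
    have e2 : s / l = 1 - s / p := by
      have : s * (1 / s - 1 / l) = s * (1 / p) := by rw [hlsp]
      rw [mul_sub, mul_one_div_cancel hs0.ne'] at this
      linarith [mul_one_div s l, mul_one_div s p]
    rw [hμz, Real.div_rpow (Real.rpow_nonneg (hB0 _) _) hZ0, ← Real.rpow_mul (hB0 _), e1, e2,
      Real.rpow_sub hZpos, Real.rpow_one]
    simp only [hα]
    field_simp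
  have key := one_le_of_marginal_bounds (univ.map (Fin.succEmb k))
    (by rw [map_nonempty]; exact ⟨⟨0, hk⟩, mem_univ _⟩) α hα0 hα1 μ
    (fun i j => by rw [hμ])
    (s := s) (p := p) (L := (Z ^ (1 / l))⁻¹ * (2 ^ ((k : ℝ) / s) * C)) (by linarith) hp
    (by simpa using hsp) ?_
  · rwa [inv_mul_eq_div, one_le_div (Real.rpow_pos_of_pos hZpos _)] at key
  · intro d _
    have h := mixed_littlewood_weighted k n T hs hp hT μ hμ0 (fun i => (hsum i).trans hα1) d
    rw [← div_eq_inv_mul, le_div_iff₀ (Real.rpow_pos_of_pos hZpos _), sum_mul]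
    refine le_of_eq_of_le (sum_congr rfl fun j _ => ?_) h
    have e3 : Z ^ (1 / l) = (Z ^ (s / l)) ^ (1 / s) := by
      rw [← Real.rpow_mul hZ0]; congr 1; field_simp
    rw [e3, ← Real.mul_rpow (sum_nonneg fun J _ => mul_nonneg (hα0 J)
      (prod_nonneg fun i _ => Real.rpow_nonneg (hμ0 _ _) _)) (Real.rpow_nonneg hZ0 _), sum_mul]
    congr 1
    refine sum_congr rfl fun J _ => ?_
    rw [Fin.prod_univ_succ, ← mul_assoc]
    change _ = t J * _ * _
    rw [hα_eq, prod_map]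
    simp only [Fin.coe_succEmb]
    ring

end Auxiliary

/-- Theorem 3 of Albuquerque et al., with `m = k + 1` (so `m - 1 = k`). -/
theorem stmt13 (k n : ℕ) (hk : 1 ≤ k) (p : ℝ) (hp1 : (k:ℝ) + 1 < p)
    (hp2 : p ≤ 2 * ((k:ℝ) + 1) - 2)
    (T : MultilinearMap ℝ (fun _ : Fin (k + 1) => (Fin n → ℝ)) ℝ)
    (C : ℝ) (hC : 0 ≤ C)
    (hT : ∀ x : Fin (k + 1) → (Fin n → ℝ),
      (∀ i, (∑ j, |x i j| ^ p) ^ (1/p) ≤ 1) → |T x| ≤ C) :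
    (∑ j₁ : Fin n, (∑ J : Fin k → Fin n,
        |T (fun i => Pi.single ((Fin.cons j₁ J : Fin (k + 1) → Fin n) i) (1:ℝ))|
          ^ (p / (p - ((k:ℝ) + 1) + 1)))
        ^ (((p - ((k:ℝ) + 1) + 1) / p) * (p / (p - ((k:ℝ) + 1)))))
        ^ ((p - ((k:ℝ) + 1)) / p)
      ≤ 2 ^ ((k:ℝ) * (p - ((k:ℝ) + 1) + 1) / p) * C := by
  have hk0 : (1 : ℝ) ≤ k := by exact_mod_cast hk
  have hp : 0 < p := by linarith
  have h1 : 0 < p - ((k : ℝ) + 1) := by linarith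
  have h2 : 0 < p - ((k : ℝ) + 1) + 1 := by linarith
  have h := hardy_littlewood_mixed k n hk T (s := p / (p - ((k : ℝ) + 1) + 1))
    (l := p / (p - ((k : ℝ) + 1))) (by rw [le_div_iff₀ h2]; linarith) (by positivity) hp
    (by field_simp; ring) (by field_simp; ring) hC hT
  simp only [sum_filter_insertNth, Fin.insertNth_zero'] at h
  convert h using 2
  · refine Finset.sum_congr rfl fun j _ => ?_
    congr 1
    field_simp
  · field_simp
  · congr 1
    field_simp
end
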